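/- Let λ > 2, ν > λ − 3 and ν > 0. Then for every φ ∈ (0,π), | (sin φ)^λ · ʳG_ν^{(λ)}(cos φ) − (2^λ Γ(λ+1/2))/(√π (ν+λ)^λ) · cos((ν+λ)φ − λπ/2) | ≤ (λ(λ−1) 2^{3λ/2} Γ(λ+1/2))/(√π (ν+1)^{λ+1}) · { |cot φ| + (2/3)·(λ+1)/(ν+1) + (2^{2−λ} Γ(2λ−1)/Γ(λ+1)) · ((ν+1)^{λ+1}/(ν−λ+3)^{2λ−1}) · |cot φ|^{λ−2} · ( |cot φ| + (2/3)·(2λ−1)/(ν−λ+3) ) }. -/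

import Mathlib

open Real

/-- Pochhammer symbol `(a)_n = a (a+1) ⋯ (a+n-1)` for a real base. -/
noncomputable def poch (a : ℝ) (n : ℕ) : ℝ := ∏ i ∈ Finset.range n, (a + (i : ℝ))

/-- The right generalized Gegenbauer function of fractional degree. -/
noncomputable def rG (lam nu x : ℝ) : ℝ :=
  ∑' j : ℕ, (poch (-nu) j * poch (nu + 2 * lam) j /
    ((j.factorial : ℝ) * poch (lam + 1 / 2) j)) * ((1 - x) / 2) ^ j

/-- Hypergeometric coefficient. -/
noncomputable def hc (a b c : ℝ) (n : ℕ) : ℝ :=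
  poch a n * poch b n / ((n.factorial : ℝ) * poch c n)

lemma poch_zero (a : ℝ) : poch a 0 = 1 := by simp [poch]

lemma poch_succ (a : ℝ) (n : ℕ) : poch a (n + 1) = poch a n * (a + n) := by
  simp [poch, Finset.prod_range_succ]

lemma poch_pos {c : ℝ} (hc0 : 0 < c) (n : ℕ) : 0 < poch c n := by
  unfold poch
  exact Finset.prod_pos (fun i _ => by positivity)

lemma hc_zero (a b c : ℝ) : hc a b c 0 = 1 := by simp [hc, poch_zero]

lemma hc_rec (a b : ℝ) {c : ℝ} (h : 0 < c) (n : ℕ) :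
    ((n : ℝ) + 1) * (n + c) * hc a b c (n + 1) = (n + a) * (n + b) * hc a b c n := by
  have h1 := (poch_pos h n).ne'
  have h2 : (n.factorial : ℝ) ≠ 0 := by positivity
  have h3 : (n : ℝ) + c ≠ 0 := by positivity
  have h4 : c + (n : ℝ) ≠ 0 := by positivity
  have h5 : (n : ℝ) + 1 ≠ 0 := by positivity
  unfold hc
  rw [poch_succ, poch_succ, poch_succ, Nat.factorial_succ]
  push_cast
  field_simp
  ring

/-- Coefficients of a power series converging absolutely in the open unit disc. -/
def Good (a : ℕ → ℝ) : Prop := ∀ r : ℝ, 0 ≤ r → r < 1 → Summable (fun n => |a n| * r ^ n)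

lemma Good.summable {a : ℕ → ℝ} (h : Good a) {y : ℝ} (hy : |y| < 1) :
    Summable (fun n => a n * y ^ n) := by
  refine Summable.of_norm ?_
  simpa [abs_mul, abs_pow] using h |y| (abs_nonneg y) hy

lemma good_hc (a b : ℝ) {c : ℝ} (h : 0 < c) : Good (hc a b c) := by
  intro r hr0 hr1
  have hlim : Filter.Tendsto (fun n : ℕ => |(((n : ℝ) + a) * (n + b)) / ((n + 1) * (n + c))| * r)
      Filter.atTop (nhds (|1| * r)) := by
    refine Filter.Tendsto.mul_const r (Filter.Tendsto.abs ?_)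
    have key : ∀ x z : ℝ, Filter.Tendsto (fun n : ℕ => ((n : ℝ) + x) / (n + z)) Filter.atTop (nhds 1) := by
      intro x z
      have h0 : Filter.Tendsto (fun n : ℕ => ((n : ℝ) + z)) Filter.atTop Filter.atTop :=
        Filter.tendsto_atTop_add_const_right _ _ tendsto_natCast_atTop_atTop
      have h1 : Filter.Tendsto (fun n : ℕ => 1 + (x - z) * ((n : ℝ) + z)⁻¹) Filter.atTop
          (nhds (1 + (x - z) * 0)) :=
        tendsto_const_nhds.add (tendsto_const_nhds.mul (tendsto_inv_atTop_zero.comp h0))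
      simp only [mul_zero, add_zero] at h1
      refine h1.congr' ?_
      filter_upwards [h0.eventually_gt_atTop 0] with n hn
      field_simp
      ring
    have := (key a 1).mul (key b c)
    simp only [mul_one] at this
    refine this.congr (fun n => ?_)
    rw [div_mul_div_comm]
  rw [abs_one, one_mul] at hlim
  obtain ⟨q, hq1, hq2⟩ := exists_between hr1
  refine summable_of_ratio_norm_eventually_le hq2 ?_
  filter_upwards [hlim.eventually_le_const hq1] with n hn
  have h3 : (0 : ℝ) < n + c := by positivity
  have h5 : (0 : ℝ) < n + 1 := by positivity
  have e : hc a b c (n + 1) = (((n : ℝ) + a) * (n + b)) / ((n + 1) * (n + c)) * hc a b c n := by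
    have := hc_rec a b h n
    field_simp
    linarith
  rw [e]
  generalize (((n : ℝ) + a) * (n + b)) / ((n + 1) * (n + c)) = k at hn
  simp only [norm_mul, Real.norm_eq_abs, abs_abs, abs_mul, abs_pow, abs_of_nonneg hr0, pow_succ]
  have : 0 ≤ |hc a b c n| * r ^ n := by positivity
  calc _ = (|k| * r) * (|hc a b c n| * r ^ n) := by ring
    _ ≤ _ := mul_le_mul_of_nonneg_right hn this

lemma Good.shift {a : ℕ → ℝ} (h : Good a) : Good (fun n => ((n : ℝ) + 1) * a (n + 1)) := by
  intro r hr0 hr1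
  obtain ⟨q, hq1, hq2⟩ := exists_between hr1
  have hq0 : 0 < q := by linarith
  have h1 := (summable_nat_add_iff 1).2 (h q hq0.le hq2)
  have h2 : Summable (fun n : ℕ => q⁻¹ * (|a (n + 1)| * q ^ (n + 1))) := h1.mul_left _
  have hlim : Filter.Tendsto (fun n : ℕ => (n : ℝ) * (r / q) ^ n + (r / q) ^ n) Filter.atTop (nhds (0 + 0)) := by
    have hh : r / q < 1 := (div_lt_one hq0).2 hq1
    have h0 : 0 ≤ r / q := by positivity
    exact (tendsto_self_mul_const_pow_of_lt_one h0 hh).add (tendsto_pow_atTop_nhds_zero_of_lt_one h0 hh)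
  refine Summable.of_norm_bounded_eventually_nat h2 ?_
  rw [add_zero] at hlim
  filter_upwards [hlim.eventually_le_const one_pos] with n hn
  have e : r ^ n = (r / q) ^ n * q ^ n := by rw [div_pow]; field_simp
  have e1 : |(n : ℝ) + 1| = n + 1 := abs_of_pos (by positivity)
  simp only [norm_mul, Real.norm_eq_abs, abs_abs, abs_mul, abs_of_nonneg (pow_nonneg hr0 n), e1]
  rw [e, pow_succ]
  have : 0 ≤ |a (n + 1)| * q ^ n := by positivity
  calc _ = ((n : ℝ) * (r / q) ^ n + (r / q) ^ n) * (|a (n + 1)| * q ^ n) := by ring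
    _ ≤ 1 * (|a (n + 1)| * q ^ n) := mul_le_mul_of_nonneg_right hn this
    _ = _ := by field_simp

/-- Sum of a power series. -/
noncomputable def ps (a : ℕ → ℝ) (y : ℝ) : ℝ := ∑' n, a n * y ^ n

/-- Coefficients of the derivative. -/
noncomputable def dc (a : ℕ → ℝ) : ℕ → ℝ := fun n => ((n : ℝ) + 1) * a (n + 1)

lemma ps_zero (a : ℕ → ℝ) : ps a 0 = a 0 := by
  unfold ps
  rw [tsum_eq_single 0]
  · simp
  · intro n hn; simp [hn]

lemma hasDerivAt_ps {a : ℕ → ℝ} (h : Good a) {y : ℝ} (hy : |y| < 1) :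
    HasDerivAt (ps a) (ps (dc a) y) y := by
  obtain ⟨q, hq1, hq2⟩ := exists_between hy
  have hq0 : 0 < q := lt_of_le_of_lt (abs_nonneg y) hq1
  have hu : Summable (fun n : ℕ => |a n| * (n * q ^ (n - 1))) := by
    rw [← summable_nat_add_iff 1]
    refine (h.shift q hq0.le hq2).congr (fun n => ?_)
    rw [abs_mul, abs_of_pos (by positivity : (0 : ℝ) < (n : ℝ) + 1)]
    push_cast
    try simp only [Nat.add_sub_cancel]
    ring
  have key := hasDerivAt_tsum_of_isPreconnected (g := fun n y => a n * y ^ n)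
    (g' := fun n y => a n * (n * y ^ (n - 1))) (t := Metric.ball (0 : ℝ) q) (y₀ := y) (y := y) hu
    Metric.isOpen_ball (convex_ball (0 : ℝ) q).isPreconnected
    (fun n x _ => (hasDerivAt_pow n x).const_mul (a n))
    (fun n x hx => by
      have hx' : |x| ≤ q := by simpa using (Metric.mem_ball.1 hx).le
      simp only [norm_mul, Real.norm_eq_abs, abs_pow, Nat.abs_cast]
      gcongr)
    (by simpa using hq1) (h.summable hy) (by simpa using hq1)
  have e : ps (dc a) y = ∑' n, a n * ((n : ℝ) * y ^ (n - 1)) := by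
    rw [Summable.tsum_eq_zero_add]
    · simp only [CharP.cast_eq_zero, zero_mul, mul_zero, zero_add, Nat.add_sub_cancel]
      unfold ps dc
      congr 1
      ext n
      push_cast
      ring
    · rw [← summable_nat_add_iff 1]
      refine (Good.summable h.shift hy).congr (fun n => ?_)
      push_cast
      try simp only [Nat.add_sub_cancel]
      ring
  rw [e]
  exact key

lemma good_dc {a : ℕ → ℝ} (h : Good a) : Good (dc a) := h.shift

lemma good_mul_n {a : ℕ → ℝ} (h : Good a) : Good (fun n => (n : ℝ) * a n) := by
  intro r h0 h1
  rw [← summable_nat_add_iff 1]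
  refine ((h.shift r h0 h1).mul_right r).congr (fun n => ?_)
  push_cast
  ring

lemma y_mul_dc {a : ℕ → ℝ} (h : Good a) {y : ℝ} (hy : |y| < 1) :
    y * ps (dc a) y = ps (fun n => (n : ℝ) * a n) y := by
  unfold ps
  rw [(good_mul_n h).summable hy |>.tsum_eq_zero_add, ← tsum_mul_left]
  simp only [CharP.cast_eq_zero, zero_mul, zero_add]
  congr 1
  ext n
  unfold dc
  push_cast
  ring

lemma ps_add {a b : ℕ → ℝ} (ha : Good a) (hb : Good b) {y : ℝ} (hy : |y| < 1) (s t : ℝ) :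
    s * ps a y + t * ps b y = ps (fun n => s * a n + t * b n) y := by
  unfold ps
  rw [← tsum_mul_left, ← tsum_mul_left, ← ((ha.summable hy).mul_left s).tsum_add ((hb.summable hy).mul_left t)]
  congr 1
  ext n
  ring

lemma good_lin {a b : ℕ → ℝ} (ha : Good a) (hb : Good b) (s t : ℝ) :
    Good (fun n => s * a n + t * b n) := by
  intro r h0 h1
  refine Summable.of_nonneg_of_le (fun n => by positivity) (fun n => ?_)
    (((ha r h0 h1).mul_left |s|).add ((hb r h0 h1).mul_left |t|))
  have : |s * a n + t * b n| ≤ |s| * |a n| + |t| * |b n| := by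
    rw [← abs_mul, ← abs_mul]; exact abs_add_le _ _
  calc _ ≤ (|s| * |a n| + |t| * |b n|) * r ^ n := mul_le_mul_of_nonneg_right this (by positivity)
    _ = _ := by ring

/-- The hypergeometric differential equation. -/
lemma hyp_ode (a b : ℝ) {c : ℝ} (h : 0 < c) {y : ℝ} (hy : |y| < 1) :
    y * (1 - y) * ps (dc (dc (hc a b c))) y + (c - (a + b + 1) * y) * ps (dc (hc a b c)) y
      - a * b * ps (hc a b c) y = 0 := by
  set A := hc a b c with hA
  have gA : Good A := good_hc a b h
  have g1 := good_dc gA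
  have g1n := good_mul_n g1
  have gAn := good_mul_n gA
  have e1 : y * ps (dc (dc A)) y = ps (fun n => (n : ℝ) * dc A n) y := y_mul_dc g1 hy
  have e2 : y * ps (dc A) y = ps (fun n => (n : ℝ) * A n) y := y_mul_dc gA hy
  have gm : Good (fun n => 1 * ((n : ℝ) * A n) + (-1) * A n) := good_lin gAn gA _ _
  have e3 : y * ps (fun n => (n : ℝ) * dc A n) y =
      ps (fun n => (n : ℝ) * (1 * ((n : ℝ) * A n) + (-1) * A n)) y := by
    rw [← y_mul_dc gm hy]
    congr 2
    ext n
    unfold dc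
    push_cast
    ring
  have e4 := ps_add g1n g1 hy 1 c
  have e5 := ps_add (good_mul_n gm) gAn hy 1 (a + b + 1)
  have e6 := ps_add (good_lin (good_mul_n gm) gAn 1 (a + b + 1)) gA hy 1 (a * b)
  have e7 : ps (fun n => 1 * ((n : ℝ) * dc A n) + c * dc A n) y =
      ps (fun n => 1 * (1 * ((n : ℝ) * (1 * ((n : ℝ) * A n) + (-1) * A n)) + (a + b + 1) * ((n : ℝ) * A n))
        + a * b * A n) y := by
    congr 1
    ext n
    have := hc_rec a b h n
    rw [← hA] at this
    unfold dc
    linear_combination this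
  rw [← e4, ← e6, ← e5, ← e3, ← e2, ← e1] at e7
  linear_combination e7

lemma binom_ps (d : ℝ) {y : ℝ} (hy : |y| < 1) : ps (hc (-d) 1 1) y = (1 - y) ^ d := by
  have gA := good_hc (-d) 1 (c := 1) one_pos
  have hder : ∀ x ∈ Set.Ioo (-1 : ℝ) 1, HasDerivAt (fun x => ps (hc (-d) 1 1) x * (1 - x) ^ (-d)) 0 x := by
    intro x hx
    have hx' : |x| < 1 := abs_lt.2 hx
    have h1 := hasDerivAt_ps gA hx'
    have h0 : (0 : ℝ) < 1 - x := by linarith [hx.2]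
    have h2 : HasDerivAt (fun x : ℝ => (1 - x) ^ (-d)) (-1 * (-d) * (1 - x) ^ (-d - 1)) x :=
      HasDerivAt.rpow_const (by simpa using (hasDerivAt_id x).const_sub 1) (Or.inl h0.ne')
    have e2 := y_mul_dc gA hx'
    have e3 := ps_add (good_mul_n gA) gA hx' 1 (-d)
    have e4 : ps (fun n => 1 * ((n : ℝ) * hc (-d) 1 1 n) + -d * hc (-d) 1 1 n) x = ps (dc (hc (-d) 1 1)) x := by
      congr 1
      ext n
      have := hc_rec (-d) 1 (c := 1) one_pos n
      unfold dc
      have h5 : (n : ℝ) + 1 ≠ 0 := by positivity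
      apply mul_left_cancel₀ h5
      linear_combination -this
    rw [e4, ← e2] at e3
    have e5 : ps (dc (hc (-d) 1 1)) x * (1 - x) ^ (-d) +
        ps (hc (-d) 1 1) x * (-1 * (-d) * (1 - x) ^ (-d - 1)) = 0 := by
      rw [Real.rpow_sub_one h0.ne']
      field_simp
      linear_combination (-(1 - x) ^ (-d)) * e3
    rw [← e5]
    exact h1.mul h2
  have hc' := (isOpen_Ioo (a := (-1 : ℝ)) (b := 1)).is_const_of_deriv_eq_zero
    isPreconnected_Ioo (fun x hx => (hder x hx).differentiableAt.differentiableWithinAt)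
    (fun x hx => (hder x hx).deriv) (abs_lt.1 hy) (⟨by norm_num, by norm_num⟩ : (0 : ℝ) ∈ Set.Ioo (-1 : ℝ) 1)
  have h0 : (0 : ℝ) < 1 - y := by linarith [(abs_lt.1 hy).2]
  simp only [ps_zero, hc_zero, sub_zero, Real.one_rpow, mul_one] at hc'
  rw [Real.rpow_neg h0.le] at hc'
  have : (1 - y) ^ d ≠ 0 := (Real.rpow_pos_of_pos h0 d).ne'
  field_simp at hc'
  exact hc'

open PowerSeries in
lemma euler_formal (a b : ℝ) {c : ℝ} (h : 0 < c) (f : PowerSeries ℝ) (h0 : coeff 0 f = 1)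
    (hf : X * (1 - X) * d⁄dX ℝ (d⁄dX ℝ f) + (C c - C (a + b + 1) * X) * d⁄dX ℝ f
      - C (a * b) * f = 0) (n : ℕ) : coeff n f = hc a b c n := by
  induction n with
  | zero => rw [h0, hc_zero]
  | succ n ih =>
    have h1 := hc_rec a b h n
    have h2 : ((n : ℝ) + 1) * (n + c) * coeff (n + 1) f = (n + a) * (n + b) * coeff n f := by
      have e : X * (1 - X) * d⁄dX ℝ (d⁄dX ℝ f) + (C c - C (a + b + 1) * X) * d⁄dX ℝ f
          - C (a * b) * f = X * d⁄dX ℝ (d⁄dX ℝ f) - X * (X * d⁄dX ℝ (d⁄dX ℝ f)) + C c * d⁄dX ℝ f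
            - C (a + b + 1) * (X * d⁄dX ℝ f) - C (a * b) * f := by ring
      rw [e] at hf
      have hn := congrArg (coeff n) hf
      obtain ⟨s, hs⟩ : ∃ s, s = a + b + 1 := ⟨_, rfl⟩
      rw [← hs] at hn
      simp only [map_add, map_sub, coeff_C_mul, map_zero] at hn
      rcases n with _ | n
      · simp only [coeff_zero_X_mul, coeff_derivative] at hn
        push_cast at hn ⊢
        subst hs; linear_combination hn
      · rcases n with _ | n
        · simp only [coeff_succ_X_mul, coeff_zero_X_mul, coeff_derivative] at hn
          push_cast at hn ⊢
          subst hs; linear_combination hn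
        · simp only [coeff_succ_X_mul, coeff_derivative] at hn
          push_cast at hn ⊢
          subst hs; linear_combination hn
    rw [ih, ← h1] at h2
    have h3 : ((n : ℝ) + 1) * (n + c) ≠ 0 := by positivity
    exact mul_left_cancel₀ h3 h2

open PowerSeries in
lemma mk_hyp_ode (a b : ℝ) {c : ℝ} (h : 0 < c) :
    X * (1 - X) * d⁄dX ℝ (d⁄dX ℝ (mk (hc a b c))) + (C c - C (a + b + 1) * X) * d⁄dX ℝ (mk (hc a b c))
      - C (a * b) * mk (hc a b c) = 0 := by
  set f := mk (hc a b c) with hf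
  have e : X * (1 - X) * d⁄dX ℝ (d⁄dX ℝ f) + (C c - C (a + b + 1) * X) * d⁄dX ℝ f
      - C (a * b) * f = X * d⁄dX ℝ (d⁄dX ℝ f) - X * (X * d⁄dX ℝ (d⁄dX ℝ f)) + C c * d⁄dX ℝ f
        - C (a + b + 1) * (X * d⁄dX ℝ f) - C (a * b) * f := by ring
  rw [e]
  ext n
  have h1 := hc_rec a b h n
  obtain ⟨s, hs⟩ : ∃ s, s = a + b + 1 := ⟨_, rfl⟩
  rw [← hs]
  simp only [map_add, map_sub, coeff_C_mul, map_zero]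
  rcases n with _ | n
  · simp only [coeff_zero_X_mul, coeff_derivative, hf, coeff_mk]
    push_cast at h1 ⊢
    subst hs; linear_combination h1
  · rcases n with _ | n
    · simp only [coeff_succ_X_mul, coeff_zero_X_mul, coeff_derivative, hf, coeff_mk]
      push_cast at h1 ⊢
      subst hs; linear_combination h1
    · simp only [coeff_succ_X_mul, coeff_derivative, hf, coeff_mk]
      push_cast at h1 ⊢
      subst hs; linear_combination h1

open PowerSeries in
lemma mk_binom_ode (d : ℝ) :
    (1 - X) * d⁄dX ℝ (mk (hc (-d) 1 1)) = - C d * mk (hc (-d) 1 1) := by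
  ext n
  have h1 := hc_rec (-d) 1 (c := 1) one_pos n
  have h5 : (n : ℝ) + 1 ≠ 0 := by positivity
  have h2 : ((n : ℝ) + 1) * hc (-d) 1 1 (n + 1) = (n - d) * hc (-d) 1 1 n := by
    apply mul_left_cancel₀ h5
    linear_combination h1
  rw [sub_mul, one_mul, neg_mul]
  simp only [map_sub, map_neg, coeff_C_mul]
  rcases n with _ | n
  · simp only [coeff_zero_X_mul, coeff_derivative, coeff_mk]
    push_cast at h2 ⊢
    linear_combination h2
  · simp only [coeff_succ_X_mul, coeff_derivative, coeff_mk]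
    push_cast at h2 ⊢
    linear_combination h2

/-- The Euler transformation. -/
lemma euler_transform (a b : ℝ) {c : ℝ} (h : 0 < c) {y : ℝ} (hy : |y| < 1) :
    ps (hc a b c) y = (1 - y) ^ (c - a - b) * ps (hc (c - a) (c - b) c) y := by
  open PowerSeries in
  set d := c - a - b with hd
  set B : PowerSeries ℝ := mk (hc (-d) 1 1) with hB
  set P : PowerSeries ℝ := mk (hc (c - a) (c - b) c) with hP
  have hBode : (1 - X) * d⁄dX ℝ B = - C d * B := mk_binom_ode d
  have hPode := mk_hyp_ode (c - a) (c - b) h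
  rw [← hP] at hPode
  have hB2 : (1 - X) * d⁄dX ℝ (d⁄dX ℝ B) = d⁄dX ℝ B - C d * d⁄dX ℝ B := by
    have := congrArg (d⁄dX ℝ) hBode
    simp only [Derivation.leibniz, map_sub, map_neg, derivative_C, derivative_one, derivative_X,
      smul_eq_mul, neg_mul] at this
    linear_combination this
  have hf : X * (1 - X) * d⁄dX ℝ (d⁄dX ℝ (B * P)) + (C c - C (a + b + 1) * X) * d⁄dX ℝ (B * P)
      - C (a * b) * (B * P) = 0 := by
    have c1 : C (a + b + 1) = C a + C b + 1 := by simp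
    have c2 : C (c - a + (c - b) + 1) = 2 * C c - C a - C b + (1 : PowerSeries ℝ) := by
      simp only [map_add, map_sub, map_one]; ring
    have c3 : C d = C c - C a - (C b : PowerSeries ℝ) := by rw [hd]; simp
    have c4 : C ((c - a) * (c - b)) = (C c - C a) * (C c - C b : PowerSeries ℝ) := by simp
    have c5 : C (a * b) = C a * (C b : PowerSeries ℝ) := by simp
    rw [c1, c5]
    simp only [Derivation.leibniz, map_add, smul_eq_mul]
    rw [c2, c4] at hPode
    rw [c3] at hBode hB2
    linear_combination B * hPode + 2 * X * d⁄dX ℝ P * hBode + X * P * hB2 + C c * P * hBode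
  have hco := euler_formal a b h (B * P) (by simp [hB, hP, coeff_mul, hc_zero]) hf
  rw [← binom_ps d hy]
  unfold ps
  have s1 := (good_hc (-d) 1 (c := 1) one_pos) |y| (abs_nonneg y) hy
  have s2 := (good_hc (c - a) (c - b) h) |y| (abs_nonneg y) hy
  rw [tsum_mul_tsum_eq_tsum_sum_antidiagonal_of_summable_norm
    (by simpa [abs_mul, abs_pow] using s1) (by simpa [abs_mul, abs_pow] using s2)]
  congr 1
  ext n
  rw [← hco n, coeff_mul, Finset.sum_mul]
  refine Finset.sum_congr rfl (fun p hp => ?_)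
  rw [← Finset.HasAntidiagonal.mem_antidiagonal.1 hp, hB, hP, coeff_mk, coeff_mk, pow_add]
  ring

lemma cos_expansion {m : ℝ} (hm : 0 < m) {u : ℝ} (hu : u ∈ Set.Ioo (-(π / 2)) (π / 2)) :
    ps (hc (1 / 2 + m) (1 / 2 - m) (1 / 2)) (Real.sin u ^ 2) * Real.cos u = Real.cos (2 * m * u) := by
  set A := hc (1 / 2 + m) (1 / 2 - m) (1 / 2) with hA
  have gA : Good A := good_hc _ _ (by norm_num)
  have hlt : ∀ x ∈ Set.Ioo (-(π / 2)) (π / 2), |Real.sin x ^ 2| < 1 := by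
    intro x hx
    have h1 := Real.cos_pos_of_mem_Ioo hx
    have h2 := Real.sin_sq_add_cos_sq x
    rw [abs_of_nonneg (by positivity)]
    nlinarith
  have hs : ∀ x : ℝ, HasDerivAt (fun x => Real.sin x ^ 2) (2 * Real.sin x * Real.cos x) x := by
    intro x
    exact ((Real.hasDerivAt_sin x).pow 2).congr_deriv (by simp)
  set h : ℝ → ℝ := fun x => ps A (Real.sin x ^ 2) * Real.cos x with hh
  set h' : ℝ → ℝ := fun x => (ps (dc A) (Real.sin x ^ 2) * (2 * Real.sin x * Real.cos x)) * Real.cos x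
    + ps A (Real.sin x ^ 2) * (-Real.sin x) with hh'
  have d1 : ∀ x ∈ Set.Ioo (-(π / 2)) (π / 2), HasDerivAt h (h' x) x := by
    intro x hx
    have e1 := (hasDerivAt_ps gA (hlt x hx)).comp x (hs x)
    exact e1.mul (Real.hasDerivAt_cos x)
  have d2 : ∀ x ∈ Set.Ioo (-(π / 2)) (π / 2), HasDerivAt h' (-(4 * m ^ 2) * h x) x := by
    intro x hx
    have e1 := (hasDerivAt_ps gA (hlt x hx)).comp x (hs x)
    have e2 := (hasDerivAt_ps (good_dc gA) (hlt x hx)).comp x (hs x)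
    have e3 := ((Real.hasDerivAt_sin x).const_mul 2).mul (Real.hasDerivAt_cos x)
    have e4 := ((e2.mul e3).mul (Real.hasDerivAt_cos x)).add (e1.mul (Real.hasDerivAt_sin x).neg)
    have ode := hyp_ode (1 / 2 + m) (1 / 2 - m) (c := 1 / 2) (by norm_num) (hlt x hx)
    rw [← hA] at ode
    have hsc := Real.sin_sq_add_cos_sq x
    refine e4.congr_deriv ?_
    simp only [hh, Function.comp, Pi.mul_apply, Pi.neg_apply]
    have hc2 : Real.sin x ^ 2 = 1 - Real.cos x ^ 2 := by linarith
    generalize ps (dc (dc A)) (Real.sin x ^ 2) = F2 at *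
    generalize ps (dc A) (Real.sin x ^ 2) = F1 at *
    generalize ps A (Real.sin x ^ 2) = F0 at *
    rw [hc2] at ode
    generalize Real.cos x = k at *
    generalize Real.sin x = s at *
    clear e1 e2 e3 e4
    linear_combination (4 * k) * ode + (4 * F2 * k ^ 3 - 6 * F1 * k) * hc2
  have hconst : ∀ K : ℝ → ℝ, (∀ x ∈ Set.Ioo (-(π / 2)) (π / 2), HasDerivAt K 0 x) → K u = K 0 := by
    intro K hK
    exact isOpen_Ioo.is_const_of_deriv_eq_zero isPreconnected_Ioo
      (fun x hx => (hK x hx).differentiableAt.differentiableWithinAt)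
      (fun x hx => (hK x hx).deriv) hu ⟨by linarith [Real.pi_pos], by linarith [Real.pi_pos]⟩
  have dm : ∀ x : ℝ, HasDerivAt (fun x => 2 * m * x) (2 * m) x := fun x => by
    simpa using (hasDerivAt_id x).const_mul (2 * m)
  have k1 := hconst (fun x => 2 * m * h x * Real.cos (2 * m * x) - h' x * Real.sin (2 * m * x)) (by
    intro x hx
    refine ((((d1 x hx).const_mul (2 * m)).mul (dm x).cos).sub ((d2 x hx).mul (dm x).sin)).congr_deriv ?_
    ring)
  have k2 := hconst (fun x => 2 * m * h x * Real.sin (2 * m * x) + h' x * Real.cos (2 * m * x)) (by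
    intro x hx
    refine ((((d1 x hx).const_mul (2 * m)).mul (dm x).sin).add ((d2 x hx).mul (dm x).cos)).congr_deriv ?_
    ring)
  have h0 : h 0 = 1 := by simp [hh, ps_zero, hA, hc_zero]
  have h0' : h' 0 = 0 := by simp [hh']
  simp only [h0, h0', mul_zero, Real.cos_zero, Real.sin_zero] at k1 k2
  have hsc := Real.sin_sq_add_cos_sq (2 * m * u)
  have : 2 * m * h u = 2 * m * Real.cos (2 * m * u) := by
    linear_combination Real.cos (2 * m * u) * k1 + Real.sin (2 * m * u) * k2 - 2 * m * h u * hsc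
  exact mul_left_cancel₀ (by positivity) this

lemma beta_real {l : ℝ} (hl : 0 < l) :
    ∫ x in (0 : ℝ)..1, (x * (1 - x)) ^ (l - 1) = Real.Gamma l * Real.Gamma l / Real.Gamma (2 * l) := by
  have h := Complex.betaIntegral_eq_Gamma_mul_div (l : ℂ) l (by simpa) (by simpa)
  unfold Complex.betaIntegral at h
  have e : ∫ x in (0 : ℝ)..1, (x : ℂ) ^ ((l : ℂ) - 1) * (1 - (x : ℂ)) ^ ((l : ℂ) - 1) =
      ∫ x in (0 : ℝ)..1, (((x * (1 - x)) ^ (l - 1) : ℝ) : ℂ) := by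
    refine intervalIntegral.integral_congr (fun x hx => ?_)
    rw [Set.uIcc_of_le zero_le_one] at hx
    rw [Real.mul_rpow hx.1 (by linarith [hx.2])]
    push_cast [Complex.ofReal_cpow hx.1, Complex.ofReal_cpow (by linarith [hx.2] : 0 ≤ 1 - x)]
    rfl
  rw [e, intervalIntegral.integral_ofReal] at h
  have e2 : (l : ℂ) + l = ((2 * l : ℝ) : ℂ) := by push_cast; ring
  rw [e2, Complex.Gamma_ofReal, Complex.Gamma_ofReal] at h
  exact_mod_cast h

/-- Moments of the kernel. -/
noncomputable def Jm (l s : ℝ) (n : ℕ) : ℝ := ∫ v in (0 : ℝ)..s, v ^ (2 * n) * (s ^ 2 - v ^ 2) ^ (l - 1)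

lemma Jm_zero {l s : ℝ} (hl : 1 < l) (hs : 0 < s) :
    Jm l s 0 = (s ^ 2) ^ (l - 1 / 2) * (Real.sqrt π * Real.Gamma l / (2 * Real.Gamma (l + 1 / 2))) := by
  have hG1 := Real.Gamma_pos_of_pos (show 0 < l by linarith)
  have hG2 := Real.Gamma_pos_of_pos (show 0 < l + 1 / 2 by linarith)
  have hG3 := Real.Gamma_pos_of_pos (show 0 < 2 * l by linarith)
  set f : ℝ → ℝ := fun v => (s ^ 2 - v ^ 2) ^ (l - 1) with hf
  have hfc : Continuous f := by
    refine Continuous.rpow_const (by fun_prop) (fun x => Or.inr (by linarith))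
  have h1 := intervalIntegral.integral_comp_mul_add (a := 0) (b := 1) f (show 2 * s ≠ 0 by positivity) (-s)
  have h2 : ∫ x in (0 : ℝ)..1, f (2 * s * x + -s) =
      (4 * s ^ 2) ^ (l - 1) * ∫ x in (0 : ℝ)..1, (x * (1 - x)) ^ (l - 1) := by
    rw [← intervalIntegral.integral_const_mul]
    refine intervalIntegral.integral_congr (fun x hx => ?_)
    rw [Set.uIcc_of_le zero_le_one] at hx
    simp only [hf]
    rw [← Real.mul_rpow (by positivity) (mul_nonneg hx.1 (by linarith [hx.2]))]
    congr 1
    ring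
  have h3 : ∫ x in (-s)..0, f x = ∫ x in (0 : ℝ)..s, f x := by
    have := intervalIntegral.integral_comp_neg (a := 0) (b := s) f
    simp only [neg_zero] at this
    rw [← this]
    refine intervalIntegral.integral_congr (fun x hx => ?_)
    simp [hf]
  have h4 := intervalIntegral.integral_add_adjacent_intervals
    (hfc.intervalIntegrable (-s) 0) (hfc.intervalIntegrable (μ := MeasureTheory.volume) 0 s)
  have h5 : Jm l s 0 = ∫ x in (0 : ℝ)..s, f x := by simp [Jm, hf]
  rw [h2, beta_real (by linarith)] at h1
  have e1 : 2 * s * 0 + -s = -s := by ring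
  have e2 : 2 * s * 1 + -s = s := by ring
  rw [e1, e2, ← h4, h3, ← h5, smul_eq_mul] at h1
  have h6 := Real.Gamma_mul_Gamma_add_half l
  have h7 : (4 * s ^ 2 : ℝ) ^ (l - 1) = 2 ^ (2 * l - 2) * (s ^ 2) ^ (l - 1) := by
    rw [Real.mul_rpow (by norm_num) (by positivity)]
    congr 1
    rw [show (4 : ℝ) = 2 ^ (2 : ℝ) by norm_num, ← Real.rpow_mul (by norm_num)]
    congr 1; ring
  have h8 : (s ^ 2) ^ (l - 1 / 2) = (s ^ 2) ^ (l - 1) * s := by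
    rw [show l - 1 / 2 = (l - 1) + 1 / 2 by ring, Real.rpow_add (by positivity), ← Real.sqrt_eq_rpow,
      Real.sqrt_sq hs.le]
  have h9 : (2 : ℝ) ^ (2 * l - 2) * 2 ^ (1 - 2 * l) = 1 / 2 := by
    rw [← Real.rpow_add (by norm_num), show 2 * l - 2 + (1 - 2 * l) = -1 by ring, Real.rpow_neg_one]
    norm_num
  rw [h7] at h1
  rw [h8]
  generalize (2 : ℝ) ^ (2 * l - 2) = p at *
  generalize (2 : ℝ) ^ (1 - 2 * l) = q at *
  generalize (s ^ 2 : ℝ) ^ (l - 1) = w at *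
  generalize Real.sqrt π = r at *
  generalize Real.Gamma l = g at *
  generalize Real.Gamma (l + 1 / 2) = g2 at *
  generalize Real.Gamma (2 * l) = g3 at *
  field_simp at h1
  field_simp
  have h10 : g3 * g * (Jm l s 0 * 2 * g2) = g3 * g * (w * s * r * g) := by
    linear_combination (-g * g2) * h1 + 2 * w * s * p * g ^ 2 * h6 + 2 * w * s * g ^ 2 * g3 * r * h9
  exact mul_left_cancel₀ (by positivity) h10

lemma Jm_rec {l s : ℝ} (hl : 1 < l) (hs : 0 < s) (n : ℕ) :
    (l + 1 / 2 + n) * Jm l s (n + 1) = (1 / 2 + n) * s ^ 2 * Jm l s n := by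
  have hc0 : ∀ p : ℝ, 0 ≤ p → Continuous (fun v : ℝ => (s ^ 2 - v ^ 2) ^ p) := fun p hp =>
    Continuous.rpow_const (by fun_prop) (fun x => Or.inr hp)
  have hc1 := hc0 (l - 1) (by linarith)
  have hder : ∀ v ∈ Set.uIcc 0 s, HasDerivAt (fun v : ℝ => v ^ (2 * n + 1) * (s ^ 2 - v ^ 2) ^ l)
      ((2 * n + 1 : ℝ) * s ^ 2 * (v ^ (2 * n) * (s ^ 2 - v ^ 2) ^ (l - 1)) -
        (2 * n + 1 + 2 * l : ℝ) * (v ^ (2 * (n + 1)) * (s ^ 2 - v ^ 2) ^ (l - 1))) v := by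
    intro v hv
    rw [Set.uIcc_of_le hs.le] at hv
    have h1 := hasDerivAt_pow (2 * n + 1) v
    have h2 : HasDerivAt (fun v : ℝ => s ^ 2 - v ^ 2) (-(2 * v)) v := by
      simpa using (hasDerivAt_pow 2 v).const_sub (s ^ 2)
    have h3 := h2.rpow_const (p := l) (Or.inr hl.le)
    refine (h1.mul h3).congr_deriv ?_
    have h4 : (s ^ 2 - v ^ 2) ^ l = (s ^ 2 - v ^ 2) ^ (l - 1) * (s ^ 2 - v ^ 2) := by
      conv_lhs => rw [show l = (l - 1) + 1 by ring]
      rw [Real.rpow_add_one' (by nlinarith [hv.1, hv.2]) (by linarith)]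
    rw [h4]
    push_cast
    try simp only [Nat.add_sub_cancel]
    ring
  have hi : ∀ k : ℕ, IntervalIntegrable (fun v : ℝ => v ^ (2 * k) * (s ^ 2 - v ^ 2) ^ (l - 1))
      MeasureTheory.volume 0 s := fun k => ((continuous_pow _).mul hc1).intervalIntegrable _ _
  have hI := intervalIntegral.integral_eq_sub_of_hasDerivAt hder
    (((hi n).const_mul _).sub ((hi (n + 1)).const_mul _))
  rw [intervalIntegral.integral_sub ((hi n).const_mul _) ((hi (n + 1)).const_mul _),
    intervalIntegral.integral_const_mul, intervalIntegral.integral_const_mul] at hI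
  rw [sub_self, Real.zero_rpow (by linarith)] at hI
  simp only [mul_zero, ne_eq, Nat.add_eq_zero_iff, one_ne_zero, and_false, not_false_eq_true,
    zero_pow, zero_mul, sub_self] at hI
  unfold Jm
  linear_combination (-1 / 2 : ℝ) * hI

lemma Jm_eq {l s : ℝ} (hl : 1 < l) (hs : 0 < s) (n : ℕ) :
    Jm l s n = poch (1 / 2) n / poch (l + 1 / 2) n * (s ^ 2) ^ n * Jm l s 0 := by
  induction n with
  | zero => simp [poch_zero]
  | succ n ih =>
    have h1 := Jm_rec hl hs n
    have h2 : 0 < l + 1 / 2 + n := by positivity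
    have h3 := poch_pos (show 0 < l + 1 / 2 by linarith) n
    rw [ih] at h1
    rw [poch_succ, poch_succ]
    apply mul_left_cancel₀ h2.ne'
    rw [h1]
    generalize poch (l + 1 / 2) n = z at *
    rw [pow_succ]
    field_simp
    try ring

lemma moment_sum {l s : ℝ} (m : ℝ) (hl : 1 < l) (hs : 0 < s) (hs1 : s < 1) :
    ∫ v in (0 : ℝ)..s, ps (hc (1 / 2 + m) (1 / 2 - m) (1 / 2)) (v ^ 2) * (s ^ 2 - v ^ 2) ^ (l - 1) =
      Jm l s 0 * ps (hc (1 / 2 + m) (1 / 2 - m) (l + 1 / 2)) (s ^ 2) := by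
  set A := hc (1 / 2 + m) (1 / 2 - m) (1 / 2) with hA
  have gA : Good A := good_hc _ _ (by norm_num)
  have hss : s ^ 2 < 1 := by nlinarith
  have hsum := gA (s ^ 2) (by positivity) hss
  have hc1 : Continuous (fun v : ℝ => (s ^ 2 - v ^ 2) ^ (l - 1)) :=
    Continuous.rpow_const (by fun_prop) (fun x => Or.inr (by linarith))
  have key := intervalIntegral.hasSum_integral_of_dominated_convergence (a := 0) (b := s)
    (μ := MeasureTheory.volume)
    (F := fun n v => A n * (v ^ (2 * n) * (s ^ 2 - v ^ 2) ^ (l - 1)))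
    (f := fun v => ps A (v ^ 2) * (s ^ 2 - v ^ 2) ^ (l - 1))
    (fun n _ => |A n| * (s ^ 2) ^ n * (s ^ 2) ^ (l - 1))
    (fun n => (continuous_const.mul ((continuous_pow _).mul hc1)).aestronglyMeasurable)
    (fun n => Filter.Eventually.of_forall (fun v hv => by
      rw [Set.uIoc_of_le hs.le] at hv
      have h1 : v ^ 2 ≤ s ^ 2 := by nlinarith [hv.1, hv.2]
      have h2 : (0 : ℝ) ≤ (s ^ 2 - v ^ 2) ^ (l - 1) := Real.rpow_nonneg (by linarith) _
      have h3 : (s ^ 2 - v ^ 2) ^ (l - 1) ≤ (s ^ 2) ^ (l - 1) :=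
        Real.rpow_le_rpow (by linarith) (by nlinarith) (by linarith)
      rw [norm_mul, norm_mul, Real.norm_eq_abs, pow_mul, Real.norm_eq_abs, Real.norm_eq_abs,
        abs_of_nonneg h2, abs_of_nonneg (by positivity : (0 : ℝ) ≤ (v ^ 2) ^ n), mul_assoc]
      gcongr))
    (Filter.Eventually.of_forall (fun v hv => hsum.mul_right _))
    (by simp)
    (Filter.Eventually.of_forall (fun v hv => by
      rw [Set.uIoc_of_le hs.le] at hv
      have h1 : v ^ 2 ≤ s ^ 2 := by nlinarith [hv.1, hv.2]
      have h2 : |v ^ 2| < 1 := by rw [abs_of_nonneg (by positivity)]; linarith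
      have := (gA.summable h2).hasSum.mul_right ((s ^ 2 - v ^ 2) ^ (l - 1))
      have e : (fun n => A n * (v ^ (2 * n) * (s ^ 2 - v ^ 2) ^ (l - 1))) =
          fun n => A n * (v ^ 2) ^ n * (s ^ 2 - v ^ 2) ^ (l - 1) := by
        ext n
        rw [pow_mul]
        ring
      rw [e]
      exact this))
  rw [← key.tsum_eq]
  unfold ps
  rw [← tsum_mul_left]
  congr 1
  ext n
  rw [intervalIntegral.integral_const_mul]
  change A n * Jm l s n = _
  rw [Jm_eq hl hs, hA]
  unfold hc
  have h3 := poch_pos (show 0 < l + 1 / 2 by linarith) n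
  have h4 := poch_pos (show (0 : ℝ) < 1 / 2 by norm_num) n
  field_simp

lemma cos_half (x : ℝ) : Real.cos x = 2 * Real.cos (x / 2) ^ 2 - 1 := by
  rw [← Real.cos_two_mul]
  congr 1
  ring

lemma mehler_subst {l m φ : ℝ} (hl : 1 < l) (hm : 0 < m) (hφ : φ ∈ Set.Ioo 0 π) :
    ∫ θ in (0 : ℝ)..φ, Real.cos (m * θ) * (Real.cos θ - Real.cos φ) ^ (l - 1) =
      2 ^ l * ∫ v in (0 : ℝ)..Real.sin (φ / 2),
        ps (hc (1 / 2 + m) (1 / 2 - m) (1 / 2)) (v ^ 2) * (Real.sin (φ / 2) ^ 2 - v ^ 2) ^ (l - 1) := by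
  obtain ⟨h0, hpi⟩ := hφ
  set A := hc (1 / 2 + m) (1 / 2 - m) (1 / 2) with hA
  have gA : Good A := good_hc _ _ (by norm_num)
  set s := Real.sin (φ / 2) with hs
  set g : ℝ → ℝ := fun v => ps A (v ^ 2) * (s ^ 2 - v ^ 2) ^ (l - 1) with hg
  have hder : ∀ x : ℝ, HasDerivAt (fun x => Real.sin (x / 2)) (Real.cos (x / 2) / 2) x := by
    intro x
    have := ((hasDerivAt_id x).div_const 2).sin
    exact this.congr_deriv (by simp; ring)
  have hmem : ∀ x ∈ Set.uIcc 0 φ, x / 2 ∈ Set.Ioo (-(π / 2)) (π / 2) := by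
    intro x hx
    rw [Set.uIcc_of_le h0.le] at hx
    constructor
    · linarith [hx.1, Real.pi_pos]
    · linarith [hx.2]
  have hgc : ContinuousOn g ((fun x => Real.sin (x / 2)) '' Set.uIcc 0 φ) := by
    rintro v ⟨x, hx, rfl⟩
    have h1 := Real.cos_pos_of_mem_Ioo (hmem x hx)
    have h2 := Real.sin_sq_add_cos_sq (x / 2)
    have h3 : |Real.sin (x / 2) ^ 2| < 1 := by
      rw [abs_of_nonneg (by positivity)]; nlinarith
    apply ContinuousAt.continuousWithinAt
    apply ContinuousAt.mul
    · exact ContinuousAt.comp (f := fun v : ℝ => v ^ 2) (hasDerivAt_ps gA h3).continuousAt (by fun_prop)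
    · exact ContinuousAt.rpow_const (by fun_prop) (Or.inr (by linarith))
  have key := intervalIntegral.integral_comp_mul_deriv'' (a := 0) (b := φ)
    (f := fun x => Real.sin (x / 2)) (f' := fun x => Real.cos (x / 2) / 2) (g := g)
    (by fun_prop) (fun x _ => (hder x).hasDerivWithinAt) (by fun_prop) hgc
  simp only [zero_div, Real.sin_zero] at key
  rw [← hs] at key
  rw [← key, ← intervalIntegral.integral_const_mul]
  refine intervalIntegral.integral_congr (fun x hx => ?_)
  have h1 := cos_expansion hm (hmem x hx)
  rw [← hA] at h1
  have h2 : 2 * m * (x / 2) = m * x := by ring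
  rw [h2] at h1
  have h3 : Real.cos x - Real.cos φ = 2 * (s ^ 2 - Real.sin (x / 2) ^ 2) := by
    have e1 := cos_half x
    have e2 := cos_half φ
    have e3 := Real.sin_sq_add_cos_sq (x / 2)
    have e4 := Real.sin_sq_add_cos_sq (φ / 2)
    rw [← hs] at e4
    linarith
  rw [Set.uIcc_of_le h0.le] at hx
  have h4 : Real.sin (x / 2) ≤ s :=
    Real.sin_le_sin_of_le_of_le_pi_div_two (by linarith [hx.1, Real.pi_pos]) (by linarith) (by linarith [hx.2])
  have h5 : 0 ≤ Real.sin (x / 2) :=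
    Real.sin_nonneg_of_nonneg_of_le_pi (by linarith [hx.1]) (by linarith [hx.2, Real.pi_pos])
  simp only [hg, Function.comp]
  rw [← h1, h3, Real.mul_rpow (by norm_num) (by nlinarith)]
  have h6 : (2 : ℝ) ^ l = 2 ^ (l - 1) * 2 := by
    rw [← Real.rpow_add_one (by norm_num)]; congr 1; ring
  rw [h6]
  ring

lemma mehler {l n φ : ℝ} (hl : 1 < l) (hm : 0 < n + l) (hφ : φ ∈ Set.Ioo 0 π) :
    Real.sin φ ^ l * rG l n (Real.cos φ) =
      2 ^ l * Real.Gamma (l + 1 / 2) / (Real.sqrt π * Real.Gamma l) * Real.sin φ ^ (1 - l) *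
      ∫ θ in (0 : ℝ)..φ, Real.cos ((n + l) * θ) * (Real.cos θ - Real.cos φ) ^ (l - 1) := by
  obtain ⟨h0, hpi⟩ := hφ
  have hs0 : 0 < Real.sin (φ / 2) := Real.sin_pos_of_pos_of_lt_pi (by linarith) (by linarith)
  have hc0 : 0 < Real.cos (φ / 2) := Real.cos_pos_of_mem_Ioo ⟨by linarith, by linarith⟩
  have hsc := Real.sin_sq_add_cos_sq (φ / 2)
  have hs1 : Real.sin (φ / 2) < 1 := by nlinarith
  have hS : Real.sin φ = 2 * Real.sin (φ / 2) * Real.cos (φ / 2) := by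
    rw [← Real.sin_two_mul]; congr 1; ring
  have hSp : 0 < Real.sin φ := Real.sin_pos_of_pos_of_lt_pi h0 hpi
  have hG1 := Real.Gamma_pos_of_pos (show 0 < l by linarith)
  have hG2 := Real.Gamma_pos_of_pos (show 0 < l + 1 / 2 by linarith)
  rw [mehler_subst hl hm ⟨h0, hpi⟩, moment_sum _ hl hs0 hs1, Jm_zero hl hs0,
    euler_transform _ _ (by linarith) (by rw [abs_of_nonneg (by positivity)]; nlinarith)]
  have e1 : l + 1 / 2 - (1 / 2 + (n + l)) = -n := by ring
  have e2 : l + 1 / 2 - (1 / 2 - (n + l)) = n + 2 * l := by ring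
  have e3 : -n - (1 / 2 - (n + l)) = l - 1 / 2 := by ring
  rw [e1, e2, e3]
  have e4 : rG l n (Real.cos φ) = ps (hc (-n) (n + 2 * l) (l + 1 / 2)) (Real.sin (φ / 2) ^ 2) := by
    have : (1 - Real.cos φ) / 2 = Real.sin (φ / 2) ^ 2 := by
      have e1 := cos_half φ
      linarith [hsc]
    unfold rG ps hc
    rw [this]
  rw [e4]
  generalize ps (hc (-n) (n + 2 * l) (l + 1 / 2)) (Real.sin (φ / 2) ^ 2) = P
  have e5 : Real.sin φ ^ l = Real.sin φ ^ (1 - l) * (Real.sin φ ^ 2) ^ (l - 1 / 2) := by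
    rw [← Real.rpow_natCast, ← Real.rpow_mul hSp.le, ← Real.rpow_add hSp]
    congr 1
    push_cast
    ring
  have e6 : (Real.sin φ ^ 2) ^ (l - 1 / 2) = 2 ^ (2 * l - 1) * (Real.sin (φ / 2) ^ 2) ^ (l - 1 / 2) *
      (1 - Real.sin (φ / 2) ^ 2) ^ (l - 1 / 2) := by
    have : Real.sin φ ^ 2 = 2 ^ 2 * Real.sin (φ / 2) ^ 2 * (1 - Real.sin (φ / 2) ^ 2) := by
      rw [hS]; linear_combination 4 * Real.sin (φ / 2) ^ 2 * hsc
    rw [this, Real.mul_rpow (by positivity) (by nlinarith), Real.mul_rpow (by positivity) (by positivity)]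
    congr 2
    rw [← Real.rpow_natCast, ← Real.rpow_mul (by norm_num)]
    congr 1
    push_cast
    ring
  have e7 : (2 : ℝ) ^ (2 * l - 1) = 2 ^ l * 2 ^ l / 2 := by
    rw [← Real.rpow_add (by norm_num), ← Real.rpow_sub_one (by norm_num)]
    congr 1; ring
  rw [e5, e6, e7]
  have hp : 0 < Real.sqrt π := Real.sqrt_pos.2 Real.pi_pos
  field_simp

lemma cpow_split {r : ℝ} (hr : 0 < r) {w : ℂ} (hw : 0 < w.re) (p : ℝ) :
    ((r : ℂ) * (-Complex.I * w)) ^ (p : ℂ) =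
      ((r ^ p : ℝ) : ℂ) * Complex.exp (-(π / 2 * p : ℝ) * Complex.I) * w ^ (p : ℂ) := by
  have hw0 : w ≠ 0 := by rintro rfl; simp at hw
  have hI : -Complex.I ≠ 0 := by simp
  have hIw : -Complex.I * w ≠ 0 := mul_ne_zero hI hw0
  have hr0 : (r : ℂ) ≠ 0 := by exact_mod_cast hr.ne'
  have harg : |w.arg| < π / 2 := Complex.abs_arg_lt_pi_div_two_iff.2 (Or.inl hw)
  rw [abs_lt] at harg
  have hlog : Complex.log (-Complex.I * w) = Complex.log (-Complex.I) + Complex.log w := by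
    rw [Complex.log_mul_eq_add_log_iff hI hw0, Complex.arg_neg_I]
    constructor <;> linarith [harg.1, harg.2, Real.pi_pos]
  rw [Complex.cpow_def_of_ne_zero (mul_ne_zero hr0 hIw), Complex.cpow_def_of_ne_zero hw0,
    Complex.log_ofReal_mul hr hIw, hlog, Complex.log_neg_I, Real.rpow_def_of_pos hr, Complex.ofReal_exp,
    ← Complex.exp_add, ← Complex.exp_add]
  congr 1
  push_cast
  ring

/-- The integrand on the vertical line. -/
noncomputable def Kf (l m c t : ℝ) : ℂ :=
  ((Real.exp (-(m * t)) * Real.sinh t ^ (l - 1) : ℝ) : ℂ) *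
    (1 + Complex.I * ((c * Real.tanh (t / 2) : ℝ) : ℂ)) ^ ((l - 1 : ℝ) : ℂ)

/-- The integrand of the contour integral. -/
noncomputable def cf (l m φ : ℝ) (z : ℂ) : ℂ :=
  Complex.exp (Complex.I * m * z) * (Complex.cos z - Real.cos φ) ^ ((l - 1 : ℝ) : ℂ)

lemma sinh_mul_tanh_half (t : ℝ) : Real.sinh t * Real.tanh (t / 2) = Real.cosh t - 1 := by
  have h1 : Real.sinh t = 2 * Real.sinh (t / 2) * Real.cosh (t / 2) := by
    rw [← Real.sinh_two_mul]; congr 1; ring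
  have h2 : Real.cosh t = Real.cosh (t / 2) ^ 2 + Real.sinh (t / 2) ^ 2 := by
    rw [← Real.cosh_two_mul]; congr 1; ring
  have h3 := Real.cosh_sq (t / 2)
  have h4 := Real.cosh_pos (t / 2)
  rw [Real.tanh_eq_sinh_div_cosh, h1, h2]
  field_simp
  linarith

lemma cf_right {l m φ t : ℝ} (hφ : φ ∈ Set.Ioo 0 π) (ht : 0 < t) :
    Complex.I * cf l m φ (φ + t * Complex.I) =
      -((Real.sin φ ^ (l - 1) : ℝ) : ℂ) * (Complex.exp ((m * φ - l * π / 2 : ℝ) * Complex.I) *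
        Kf l m (Real.cos φ / Real.sin φ) t) := by
  have hS : 0 < Real.sin φ := Real.sin_pos_of_pos_of_lt_pi hφ.1 hφ.2
  have hsh : 0 < Real.sinh t := Real.sinh_pos_iff.2 ht
  set w : ℂ := 1 + Complex.I * ((Real.cos φ / Real.sin φ * Real.tanh (t / 2) : ℝ) : ℂ) with hw
  have hwre : 0 < w.re := by
    rw [hw, Complex.add_re, Complex.one_re, Complex.mul_re, Complex.I_re, Complex.I_im, Complex.ofReal_im]
    norm_num
  have hbase : Complex.cos (φ + t * Complex.I) - Real.cos φ =
      ((Real.sin φ * Real.sinh t : ℝ) : ℂ) * (-Complex.I * w) := by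
    have hk : ((Real.sinh t * Real.tanh (t / 2) : ℝ) : ℂ) = ((Real.cosh t - 1 : ℝ) : ℂ) := by
      rw [sinh_mul_tanh_half]
    rw [Complex.cos_add_mul_I, ← Complex.ofReal_cos, ← Complex.ofReal_cosh, ← Complex.ofReal_sin,
      ← Complex.ofReal_sinh, hw]
    have hS' : ((Real.sin φ : ℝ) : ℂ) ≠ 0 := by exact_mod_cast hS.ne'
    rw [Complex.ofReal_mul, Complex.ofReal_sub] at hk
    simp only [Complex.ofReal_mul, Complex.ofReal_div] at hk ⊢
    have hI := Complex.I_sq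
    generalize ((Real.sin φ : ℝ) : ℂ) = S at *
    generalize ((Real.cos φ : ℝ) : ℂ) = k at *
    generalize ((Real.sinh t : ℝ) : ℂ) = a at *
    generalize ((Real.cosh t : ℝ) : ℂ) = b at *
    generalize ((Real.tanh (t / 2) : ℝ) : ℂ) = q at *
    field_simp
    simp only [Complex.ofReal_one] at hk
    linear_combination (-k) * hk + a * k * q * hI
  unfold cf Kf
  rw [hbase, cpow_split (mul_pos hS hsh) hwre, Real.mul_rpow hS.le hsh.le, ← hw]
  have e1 : Complex.I * m * (φ + t * Complex.I) = (m * φ : ℝ) * Complex.I + (-(m * t) : ℝ) := by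
    push_cast
    linear_combination (m * t : ℂ) * Complex.I_sq
  have e2 : Complex.exp ((m * φ - l * π / 2 : ℝ) * Complex.I) =
      -Complex.I * (Complex.exp ((m * φ : ℝ) * Complex.I) * Complex.exp (-(π / 2 * (l - 1) : ℝ) * Complex.I)) := by
    have : -Complex.I = Complex.exp (-(π / 2) * Complex.I) := by
      rw [neg_mul, Complex.exp_neg, Complex.exp_pi_div_two_mul_I, Complex.inv_I]
    rw [this, ← Complex.exp_add, ← Complex.exp_add]
    congr 1
    push_cast
    ring
  rw [e1, e2, Complex.exp_add, ← Complex.ofReal_exp]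
  simp only [Complex.ofReal_mul]
  ring

lemma base_ne {φ x y : ℝ} (hφ : φ ∈ Set.Ioo 0 π) (hx : x ∈ Set.Icc 0 φ) (hy : 0 ≤ y) :
    0 ≤ (Complex.cos (x + y * Complex.I) - Real.cos φ).re ∨
      (Complex.cos (x + y * Complex.I) - Real.cos φ).im ≠ 0 := by
  have e : Complex.cos (x + y * Complex.I) - Real.cos φ =
      ((Real.cos x * Real.cosh y - Real.cos φ : ℝ) : ℂ) + ((-(Real.sin x * Real.sinh y) : ℝ) : ℂ) * Complex.I := by
    rw [Complex.cos_add_mul_I]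
    push_cast
    ring
  rw [e]
  simp only [Complex.add_re, Complex.ofReal_re, Complex.re_ofReal_mul, Complex.I_re, mul_zero, add_zero,
    Complex.add_im, Complex.ofReal_im, Complex.im_ofReal_mul, Complex.I_im, mul_one, zero_add]
  rcases hy.eq_or_lt with rfl | hy
  · left
    have := Real.cos_le_cos_of_nonneg_of_le_pi hx.1 hφ.2.le hx.2
    simp only [Real.cosh_zero, mul_one]
    linarith
  · rcases hx.1.eq_or_lt with h0 | h0
    · left
      rw [← h0]
      have := Real.one_le_cosh y
      have := Real.cos_le_one φ
      simp only [Real.cos_zero, one_mul]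
      linarith
    · right
      have h1 : 0 < Real.sin x := Real.sin_pos_of_pos_of_lt_pi h0 (by linarith [hx.2, hφ.2])
      have h2 : 0 < Real.sinh y := Real.sinh_pos_iff.2 hy
      have := mul_pos h1 h2
      exact neg_ne_zero.2 this.ne'

lemma cf_cont {l m φ : ℝ} (hl : 1 < l) (z : ℂ) (hz : 0 ≤ (Complex.cos z - Real.cos φ).re ∨
      (Complex.cos z - Real.cos φ).im ≠ 0) : ContinuousAt (cf l m φ) z := by
  unfold cf
  refine ContinuousAt.mul (by fun_prop) ?_
  refine ContinuousAt.comp (f := fun z => Complex.cos z - (Real.cos φ : ℂ))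
    (g := fun z : ℂ => z ^ ((l - 1 : ℝ) : ℂ)) ?_ (by fun_prop)
  exact Complex.continuousAt_cpow_const_of_re_pos hz (by simpa using hl)

lemma cf_norm {l m φ x y : ℝ} (hl : 1 < l) (hy : 0 ≤ y) :
    ‖cf l m φ (x + y * Complex.I)‖ ≤ 2 ^ (l - 1) * Real.exp (-((m - l + 1) * y)) := by
  unfold cf
  rw [norm_mul, Complex.norm_cpow_real, Complex.norm_exp]
  have e1 : (Complex.I * m * (x + y * Complex.I)).re = -(m * y) := by simp
  have h1 : ‖Complex.cos (x + y * Complex.I) - Real.cos φ‖ ≤ 2 * Real.exp y := by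
    have hcos : ‖Complex.cos (x + y * Complex.I)‖ ≤ Real.exp y := by
      unfold Complex.cos
      have ha : ‖Complex.exp ((x + y * Complex.I) * Complex.I)‖ = Real.exp (-y) := by
        rw [Complex.norm_exp]; simp
      have hb : ‖Complex.exp (-(x + y * Complex.I) * Complex.I)‖ = Real.exp y := by
        rw [Complex.norm_exp]; simp
      rw [norm_div, Complex.norm_two]
      have := norm_add_le (Complex.exp ((x + y * Complex.I) * Complex.I))
        (Complex.exp (-(x + y * Complex.I) * Complex.I))
      rw [ha, hb] at this
      have h2 : Real.exp (-y) ≤ Real.exp y := Real.exp_le_exp.2 (by linarith)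
      linarith
    have h3 : ‖((Real.cos φ : ℝ) : ℂ)‖ ≤ 1 := by
      rw [Complex.norm_real]; exact Real.abs_cos_le_one φ
    have h4 := Real.one_le_exp hy
    have := norm_sub_le (Complex.cos (x + y * Complex.I)) (Real.cos φ)
    linarith
  rw [e1]
  have h2 := Real.rpow_le_rpow (norm_nonneg _) h1 (show 0 ≤ l - 1 by linarith)
  rw [Real.mul_rpow (by norm_num) (Real.exp_nonneg y), ← Real.exp_mul] at h2
  calc _ ≤ Real.exp (-(m * y)) * (2 ^ (l - 1) * Real.exp (y * (l - 1))) :=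
        mul_le_mul_of_nonneg_left h2 (Real.exp_nonneg _)
    _ = 2 ^ (l - 1) * (Real.exp (-(m * y)) * Real.exp (y * (l - 1))) := by ring
    _ = _ := by rw [← Real.exp_add]; congr 2; ring

lemma contour {l m φ T : ℝ} (hl : 1 < l) (hφ : φ ∈ Set.Ioo 0 π) (hT : 0 < T) :
    |(∫ θ in (0 : ℝ)..φ, Real.cos (m * θ) * (Real.cos θ - Real.cos φ) ^ (l - 1)) -
      Real.sin φ ^ (l - 1) * (Complex.exp ((m * φ - l * π / 2 : ℝ) * Complex.I) *
        ∫ t in (0 : ℝ)..T, Kf l m (Real.cos φ / Real.sin φ) t).re| ≤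
      2 ^ (l - 1) * Real.exp (-((m - l + 1) * T)) * φ := by
  have h0 := hφ.1
  have key := Complex.integral_boundary_rect_eq_zero_of_continuousOn_of_differentiableOn (cf l m φ)
    0 (φ + T * Complex.I) (by
      rintro z hz
      rw [Complex.mem_reProdIm] at hz
      simp only [Complex.zero_re, Complex.add_re, Complex.ofReal_re, Complex.re_ofReal_mul, Complex.I_re,
        mul_zero, add_zero, Complex.zero_im, Complex.add_im, Complex.ofReal_im, Complex.im_ofReal_mul,
        Complex.I_im, mul_one, zero_add, Set.uIcc_of_le h0.le, Set.uIcc_of_le hT.le] at hz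
      have := base_ne hφ hz.1 hz.2.1
      rw [Complex.re_add_im] at this
      exact (cf_cont hl z this).continuousWithinAt) (by
      rintro z hz
      rw [Complex.mem_reProdIm] at hz
      simp only [Complex.zero_re, Complex.add_re, Complex.ofReal_re, Complex.re_ofReal_mul, Complex.I_re,
        mul_zero, add_zero, Complex.zero_im, Complex.add_im, Complex.ofReal_im, Complex.im_ofReal_mul,
        Complex.I_im, mul_one, zero_add, min_eq_left h0.le, min_eq_left hT.le, max_eq_right h0.le,
        max_eq_right hT.le] at hz
      have him : (Complex.cos z - Real.cos φ).im ≠ 0 := by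
        have h1 : 0 < Real.sin z.re := Real.sin_pos_of_pos_of_lt_pi hz.1.1 (by linarith [hz.1.2, hφ.2])
        have h2 : 0 < Real.sinh z.im := Real.sinh_pos_iff.2 hz.2.1
        have e : Complex.cos z = ((Real.cos z.re * Real.cosh z.im : ℝ) : ℂ) +
            ((-(Real.sin z.re * Real.sinh z.im) : ℝ) : ℂ) * Complex.I := by
          conv_lhs => rw [← Complex.re_add_im z]
          rw [Complex.cos_add_mul_I]
          push_cast
          ring
        rw [e]
        simp only [Complex.sub_im, Complex.add_im, Complex.ofReal_im, Complex.im_ofReal_mul,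
          Complex.I_im, mul_one, zero_add, sub_zero]
        exact neg_ne_zero.2 (mul_pos h1 h2).ne'
      apply DifferentiableAt.differentiableWithinAt
      unfold cf
      refine DifferentiableAt.mul (by fun_prop) ?_
      exact DifferentiableAt.cpow_const (by fun_prop) (Or.inr him))
  simp only [Complex.zero_re, Complex.add_re, Complex.ofReal_re, Complex.re_ofReal_mul, Complex.I_re,
        mul_zero, add_zero, Complex.zero_im, Complex.add_im, Complex.ofReal_im, Complex.im_ofReal_mul,
        Complex.I_im, mul_one, zero_add, Complex.ofReal_zero, zero_mul, smul_eq_mul] at key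
  -- left side
  have hleft : (Complex.I * ∫ y in (0 : ℝ)..T, cf l m φ (y * Complex.I)).re = 0 := by
    have : ∫ y in (0 : ℝ)..T, cf l m φ (y * Complex.I) =
        ∫ y in (0 : ℝ)..T, ((Real.exp (-(m * y)) * (Real.cosh y - Real.cos φ) ^ (l - 1) : ℝ) : ℂ) := by
      refine intervalIntegral.integral_congr (fun y hy => ?_)
      have hb : 0 ≤ Real.cosh y - Real.cos φ := by linarith [Real.one_le_cosh y, Real.cos_le_one φ]
      simp only [cf]
      rw [Complex.ofReal_mul, Complex.ofReal_cpow hb, Complex.cos_mul_I]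
      push_cast
      congr 2
      linear_combination (m * y : ℂ) * Complex.I_sq
    rw [this, intervalIntegral.integral_ofReal]
    simp
  have hright : Complex.I * ∫ y in (0 : ℝ)..T, cf l m φ (φ + y * Complex.I) =
      -((Real.sin φ ^ (l - 1) : ℝ) : ℂ) * (Complex.exp ((m * φ - l * π / 2 : ℝ) * Complex.I) *
        ∫ t in (0 : ℝ)..T, Kf l m (Real.cos φ / Real.sin φ) t) := by
    rw [← intervalIntegral.integral_const_mul, ← intervalIntegral.integral_const_mul,
      ← intervalIntegral.integral_const_mul]
    refine intervalIntegral.integral_congr_ae (Filter.Eventually.of_forall (fun t ht => ?_))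
    rw [Set.uIoc_of_le hT.le] at ht
    exact cf_right hφ ht.1
  have hbot : (∫ x in (0 : ℝ)..φ, cf l m φ x).re =
      ∫ θ in (0 : ℝ)..φ, Real.cos (m * θ) * (Real.cos θ - Real.cos φ) ^ (l - 1) := by
    have hcfi : IntervalIntegrable (fun x : ℝ => cf l m φ x) MeasureTheory.volume 0 φ := by
      apply ContinuousOn.intervalIntegrable
      intro x hx
      rw [Set.uIcc_of_le h0.le] at hx
      have := base_ne (y := 0) hφ hx le_rfl
      simp only [Complex.ofReal_zero, zero_mul, add_zero] at this
      exact (ContinuousAt.comp (f := fun x : ℝ => (x : ℂ)) (cf_cont hl _ this)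
        (by fun_prop)).continuousWithinAt
    have := Complex.reCLM.intervalIntegral_comp_comm hcfi
    simp only [Complex.reCLM_apply] at this
    rw [← this]
    refine intervalIntegral.integral_congr (fun x hx => ?_)
    rw [Set.uIcc_of_le h0.le] at hx
    have hb : 0 ≤ Real.cos x - Real.cos φ := by
      linarith [Real.cos_le_cos_of_nonneg_of_le_pi hx.1 hφ.2.le hx.2]
    simp only [cf]
    rw [← Complex.ofReal_cos, ← Complex.ofReal_sub, ← Complex.ofReal_cpow hb, Complex.re_mul_ofReal]
    congr 1
    rw [show Complex.I * m * x = ((m * x : ℝ) : ℂ) * Complex.I by push_cast; ring,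
      Complex.exp_ofReal_mul_I_re]
  have htop : ‖∫ x in (0 : ℝ)..φ, cf l m φ (x + T * Complex.I)‖ ≤
      2 ^ (l - 1) * Real.exp (-((m - l + 1) * T)) * φ := by
    have := intervalIntegral.norm_integral_le_of_norm_le_const (a := 0) (b := φ)
      (f := fun x : ℝ => cf l m φ (x + T * Complex.I)) (fun x _ => cf_norm (m := m) (φ := φ) (x := x) hl hT.le)
    rwa [sub_zero, abs_of_pos h0] at this
  have hre := congrArg Complex.re key
  rw [hright] at hre
  simp only [Complex.sub_re, Complex.add_re, Complex.zero_re, hbot, hleft] at hre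
  rw [neg_mul, Complex.neg_re, Complex.re_ofReal_mul] at hre
  refine le_trans ?_ htop
  refine le_trans (le_of_eq ?_) (Complex.abs_re_le_norm _)
  congr 1
  linarith

lemma sinh_le_mul_cosh {x : ℝ} (hx : 0 ≤ x) : Real.sinh x ≤ x * Real.cosh x := by
  have hmono : MonotoneOn (fun x : ℝ => x * Real.cosh x - Real.sinh x) (Set.Ici 0) := by
    refine monotoneOn_of_deriv_nonneg (convex_Ici 0) (by fun_prop) (by fun_prop) (fun y hy => ?_)
    rw [interior_Ici] at hy
    have hd : HasDerivAt (fun x : ℝ => x * Real.cosh x - Real.sinh x)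
        (1 * Real.cosh y + y * Real.sinh y - Real.cosh y) y :=
      ((hasDerivAt_id y).mul (Real.hasDerivAt_cosh y)).sub (Real.hasDerivAt_sinh y)
    rw [hd.deriv]
    have := mul_nonneg (le_of_lt hy) (Real.sinh_nonneg_iff.2 (le_of_lt hy))
    linarith
  have := hmono (Set.mem_Ici.2 le_rfl) (Set.mem_Ici.2 hx) hx
  simp at this
  linarith

lemma tanh_le_self' {x : ℝ} (hx : 0 ≤ x) : Real.tanh x ≤ x := by
  rw [Real.tanh_eq_sinh_div_cosh, div_le_iff₀ (Real.cosh_pos x)]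
  exact sinh_le_mul_cosh hx

lemma tanh_nonneg' {x : ℝ} (hx : 0 ≤ x) : 0 ≤ Real.tanh x := by
  rw [Real.tanh_eq_sinh_div_cosh]
  exact div_nonneg (Real.sinh_nonneg_iff.2 hx) (Real.cosh_pos x).le

lemma sinh_le_mul_exp {t : ℝ} (_ht : 0 ≤ t) : Real.sinh t ≤ t * Real.exp t := by
  rw [Real.sinh_eq]
  have h := Real.add_one_le_exp (-(2 * t))
  have h2 : Real.exp (-t) = Real.exp t * Real.exp (-(2 * t)) := by rw [← Real.exp_add]; congr 1; ring
  have h3 := Real.exp_pos t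
  rw [h2]
  nlinarith

lemma sinh_sub_le {t : ℝ} (ht : 0 ≤ t) : Real.sinh t - t ≤ t ^ 3 / 4 * Real.exp t := by
  have h2 : Real.sinh t = 2 * Real.sinh (t / 2) * Real.cosh (t / 2) := by
    rw [← Real.sinh_two_mul]; congr 1; ring
  have ht2 : 0 ≤ t / 2 := by linarith
  have h1 := sinh_le_mul_cosh ht2
  have h3 := Real.cosh_sq (t / 2)
  have h4 := Real.cosh_pos (t / 2)
  have h5 : Real.sinh t ≤ t * Real.cosh (t / 2) ^ 2 := by rw [h2]; nlinarith
  have h6 := sinh_le_mul_exp ht2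
  have h7 := Real.sinh_nonneg_iff.2 ht2
  have h8 : Real.sinh (t / 2) ^ 2 ≤ (t / 2 * Real.exp (t / 2)) ^ 2 := pow_le_pow_left₀ h7 h6 2
  have h9 : Real.exp (t / 2) ^ 2 = Real.exp t := by rw [← Real.exp_nat_mul]; congr 1; push_cast; ring
  rw [mul_pow, h9] at h8
  have h10 := mul_le_mul_of_nonneg_left h8 ht
  rw [h3] at h5
  nlinarith

lemma cpow_sub_one_le {p : ℝ} (hp : 1 ≤ p) {z : ℂ} (hz : 1 ≤ z.re) :
    ‖z ^ (p : ℂ) - 1‖ ≤ p * ‖z‖ ^ (p - 1) * ‖z - 1‖ := by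
  have hz1 : 1 ≤ ‖z‖ := hz.trans (Complex.re_le_norm z)
  have hconv : Convex ℝ ({w : ℂ | 1 ≤ w.re} ∩ Metric.closedBall 0 ‖z‖) :=
    (convex_halfSpace_re_ge 1).inter (convex_closedBall _ _)
  have := hconv.norm_image_sub_le_of_norm_hasDerivWithin_le (f := fun w : ℂ => w ^ (p : ℂ))
    (f' := fun w : ℂ => (p : ℂ) * w ^ ((p : ℂ) - 1)) (C := p * ‖z‖ ^ (p - 1)) (x := 1) (y := z)
    (by
      rintro w ⟨hw, _⟩
      have hw' : 0 < w.re := lt_of_lt_of_le one_pos hw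
      have := (hasDerivAt_id w).cpow_const (c := (p : ℂ)) (Or.inl hw')
      simpa using this.hasDerivWithinAt)
    (by
      rintro w ⟨hw, hb⟩
      rw [mem_closedBall_zero_iff] at hb
      rw [norm_mul, Complex.norm_real, Real.norm_of_nonneg (by linarith),
        show (p : ℂ) - 1 = ((p - 1 : ℝ) : ℂ) by push_cast; ring, Complex.norm_cpow_real]
      exact mul_le_mul_of_nonneg_left (Real.rpow_le_rpow (norm_nonneg _) hb (by linarith)) (by linarith))
    (by
      refine ⟨by simp, ?_⟩
      simpa using hz1)
    (by
      refine ⟨hz, ?_⟩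
      simp)
  simpa using this

lemma norm_w_le {l y : ℝ} (hl : 2 < l) :
    ‖(1 + Complex.I * (y : ℂ))‖ ^ (l - 2) ≤ 2 ^ (l / 2) / 2 * (1 + |y| ^ (l - 2)) := by
  have hs : Real.sqrt 2 ^ (l - 2) = 2 ^ (l / 2) / 2 := by
    rw [Real.sqrt_eq_rpow, ← Real.rpow_mul (by norm_num), show (1 / 2 : ℝ) * (l - 2) = l / 2 - 1 by ring,
      Real.rpow_sub_one (by norm_num)]
  have hn : ‖(1 + Complex.I * (y : ℂ))‖ ≤ Real.sqrt 2 * max 1 |y| := by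
    rw [Complex.norm_def]
    refine Real.sqrt_le_iff.2 ⟨by positivity, ?_⟩
    rw [mul_pow, Real.sq_sqrt (by norm_num)]
    simp only [Complex.normSq_apply, Complex.add_re, Complex.one_re, Complex.mul_re, Complex.I_re,
      Complex.I_im, Complex.ofReal_im, Complex.ofReal_re, Complex.add_im, Complex.one_im, Complex.mul_im]
    have h1 : 1 ≤ max 1 |y| := le_max_left _ _
    have h2 : |y| ≤ max 1 |y| := le_max_right _ _
    have h3 := sq_abs y
    have h4 := abs_nonneg y
    nlinarith
  have h := Real.rpow_le_rpow (norm_nonneg _) hn (show 0 ≤ l - 2 by linarith)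
  rw [Real.mul_rpow (Real.sqrt_nonneg _) (by positivity), hs] at h
  refine h.trans (mul_le_mul_of_nonneg_left ?_ (by positivity))
  rcases le_total 1 |y| with h1 | h1
  · rw [max_eq_right h1]; linarith
  · rw [max_eq_left h1, Real.one_rpow]
    have := Real.rpow_nonneg (abs_nonneg y) (l - 2)
    linarith

lemma Kf_bound {l m c t : ℝ} (hl : 2 < l) (ht : 0 < t) :
    ‖Kf l m c t - ((t ^ (l - 1) * Real.exp (-(m * t)) : ℝ) : ℂ)‖ ≤
      (l - 1) * 2 ^ (l / 2) * ((|c| * t ^ l + 2 / 3 * t ^ (l + 1)) *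
        (Real.exp (-((m - l + 1) * t)) +
          2 ^ (2 - l) * |c| ^ (l - 2) * t ^ (l - 2) * Real.exp (-((m - 2 * l + 3) * t)))) := by
  have hsh : 0 < Real.sinh t := Real.sinh_pos_iff.2 ht
  set q := Real.sinh t / t with hq
  have hq0 : 0 < q := div_pos hsh ht
  have hq1 : 1 ≤ q := by rw [hq, one_le_div ht]; exact Real.self_le_sinh_iff.2 ht.le
  have hqe : q ≤ Real.exp t := by
    rw [hq, div_le_iff₀ ht, mul_comm]; exact sinh_le_mul_exp ht.le
  have hqm : q - 1 ≤ t ^ 2 / 4 * Real.exp t := by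
    rw [hq, div_sub_one ht.ne', div_le_iff₀ ht]
    have := sinh_sub_le ht.le
    linarith
  have hst : Real.sinh t = q * t := by rw [hq]; field_simp
  set τ := Real.tanh (t / 2) with hτ
  have hτ0 : 0 ≤ τ := tanh_nonneg' (by linarith)
  have hτ1 : τ ≤ t / 2 := tanh_le_self' (by linarith)
  set w : ℂ := 1 + Complex.I * ((c * τ : ℝ) : ℂ) with hw
  have hwre : w.re = 1 := by
    rw [hw, Complex.add_re, Complex.one_re, Complex.mul_re, Complex.I_re, Complex.I_im, Complex.ofReal_im]
    norm_num
  have hw0 : w ≠ 0 := by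
    intro h; rw [h] at hwre; simp at hwre
  have hsplit : ((q : ℂ) * w) ^ ((l - 1 : ℝ) : ℂ) = ((q ^ (l - 1) : ℝ) : ℂ) * w ^ ((l - 1 : ℝ) : ℂ) := by
    have hqc : (q : ℂ) ≠ 0 := by exact_mod_cast hq0.ne'
    rw [Complex.cpow_def_of_ne_zero (mul_ne_zero hqc hw0), Complex.cpow_def_of_ne_zero hw0,
      Complex.log_ofReal_mul hq0 hw0, Real.rpow_def_of_pos hq0, Complex.ofReal_exp, ← Complex.exp_add]
    congr 1
    rw [Complex.ofReal_mul]
    ring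
  have heq : Kf l m c t - ((t ^ (l - 1) * Real.exp (-(m * t)) : ℝ) : ℂ) =
      ((t ^ (l - 1) * Real.exp (-(m * t)) : ℝ) : ℂ) * (((q : ℂ) * w) ^ ((l - 1 : ℝ) : ℂ) - 1) := by
    unfold Kf
    rw [← hτ, ← hw, hsplit, hst, Real.mul_rpow hq0.le ht.le]
    simp only [Complex.ofReal_mul]
    ring
  have hzre : 1 ≤ ((q : ℂ) * w).re := by rw [Complex.re_ofReal_mul, hwre]; linarith
  have h1 := cpow_sub_one_le (p := l - 1) (by linarith) hzre
  rw [norm_mul, Complex.norm_real, Real.norm_of_nonneg hq0.le, show l - 1 - 1 = l - 2 by ring,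
    Real.mul_rpow hq0.le (norm_nonneg _)] at h1
  have hz1 : ‖(q : ℂ) * w - 1‖ ≤ Real.exp t * (t ^ 2 / 4 + |c| * t / 2) := by
    have e : (q : ℂ) * w - 1 = ((q - 1 : ℝ) : ℂ) + Complex.I * ((q * (c * τ) : ℝ) : ℂ) := by
      rw [hw]; push_cast; ring
    rw [e]
    refine (norm_add_le _ _).trans ?_
    rw [norm_mul, Complex.norm_I, one_mul, Complex.norm_real, Complex.norm_real,
      Real.norm_of_nonneg (by linarith), Real.norm_eq_abs, abs_mul, abs_mul, abs_of_pos hq0,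
      abs_of_nonneg hτ0]
    have : q * (|c| * τ) ≤ Real.exp t * (|c| * (t / 2)) := by gcongr
    linarith
  have hwn : ‖w‖ ^ (l - 2) ≤ 2 ^ (l / 2) / 2 * (1 + 2 ^ (2 - l) * |c| ^ (l - 2) * t ^ (l - 2)) := by
    refine (norm_w_le (y := c * τ) hl).trans (mul_le_mul_of_nonneg_left ?_ (by positivity))
    have h5 : |c * τ| ≤ |c| * (t / 2) := by
      rw [abs_mul, abs_of_nonneg hτ0]; gcongr
    have h6 := Real.rpow_le_rpow (abs_nonneg _) h5 (show 0 ≤ l - 2 by linarith)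
    rw [Real.mul_rpow (abs_nonneg _) (by positivity), Real.div_rpow ht.le (by norm_num)] at h6
    have h7 : (2 : ℝ) ^ (2 - l) = (2 ^ (l - 2))⁻¹ := by
      rw [← Real.rpow_neg (by norm_num)]; congr 1; ring
    rw [h7]
    calc _ ≤ 1 + |c| ^ (l - 2) * (t ^ (l - 2) / 2 ^ (l - 2)) := by linarith
      _ = _ := by ring
  have hqn : q ^ (l - 2) ≤ Real.exp (t * (l - 2)) := by
    rw [Real.exp_mul]; exact Real.rpow_le_rpow hq0.le hqe (by linarith)
  set Y := 2 ^ (2 - l) * |c| ^ (l - 2) * t ^ (l - 2) with hY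
  have hY0 : 0 ≤ Y := by positivity
  have hl1 : 0 < l - 1 := by linarith
  rw [heq, norm_mul, Complex.norm_real, Real.norm_of_nonneg (by positivity)]
  have htl : t ^ l = t ^ (l - 1) * t := by
    rw [← Real.rpow_add_one ht.ne']; congr 1; ring
  have htl1 : t ^ (l + 1) = t ^ (l - 1) * t ^ 2 := by
    rw [Real.rpow_add_one ht.ne', htl]; ring
  have hE : Real.exp (-(m * t)) * (Real.exp (t * (l - 2)) * Real.exp t) = Real.exp (-((m - l + 1) * t)) := by
    rw [← Real.exp_add, ← Real.exp_add]; congr 1; ring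
  have hE2 : Real.exp (-((m - l + 1) * t)) ≤ Real.exp (-((m - 2 * l + 3) * t)) := by
    apply Real.exp_le_exp.2
    nlinarith
  calc _ ≤ t ^ (l - 1) * Real.exp (-(m * t)) * ((l - 1) * (Real.exp (t * (l - 2)) *
        (2 ^ (l / 2) / 2 * (1 + Y))) * (Real.exp t * (t ^ 2 / 4 + |c| * t / 2))) := by
        refine mul_le_mul_of_nonneg_left (h1.trans ?_) (by positivity)
        gcongr
    _ = (l - 1) * 2 ^ (l / 2) * ((t ^ (l - 1) * (t ^ 2 / 8 + |c| * t / 4)) *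
        ((Real.exp (-(m * t)) * (Real.exp (t * (l - 2)) * Real.exp t)) * (1 + Y))) := by ring
    _ = (l - 1) * 2 ^ (l / 2) * ((t ^ (l - 1) * (t ^ 2 / 8 + |c| * t / 4)) *
        (Real.exp (-((m - l + 1) * t)) + Y * Real.exp (-((m - l + 1) * t)))) := by rw [hE]; ring
    _ ≤ _ := by
      rw [htl, htl1]
      refine mul_le_mul_of_nonneg_left ?_ (by positivity)
      refine mul_le_mul ?_ ?_ (by positivity) (by positivity)
      · have a1 : 0 ≤ t ^ (l - 1) * t ^ 2 := by positivity
        have a2 : 0 ≤ |c| * (t ^ (l - 1) * t) := by positivity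
        linarith
      · gcongr

lemma gint {a r : ℝ} (ha : 0 < a) (hr : 0 < r) :
    MeasureTheory.IntegrableOn (fun t : ℝ => t ^ (a - 1) * Real.exp (-(r * t))) (Set.Ioi 0) := by
  by_contra h
  have h1 := Real.integral_rpow_mul_exp_neg_mul_Ioi ha hr
  rw [MeasureTheory.integral_undef h] at h1
  have : 0 < (1 / r) ^ a * Real.Gamma a := mul_pos (by positivity) (Real.Gamma_pos_of_pos ha)
  linarith

lemma gint_int {a r T : ℝ} (ha : 0 < a) (hr : 0 < r) (hT : 0 < T) :
    IntervalIntegrable (fun t : ℝ => t ^ (a - 1) * Real.exp (-(r * t))) MeasureTheory.volume 0 T := by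
  rw [intervalIntegrable_iff_integrableOn_Ioc_of_le hT.le]
  exact (gint ha hr).mono_set Set.Ioc_subset_Ioi_self

lemma gint_le {a r T : ℝ} (ha : 0 < a) (hr : 0 < r) (hT : 0 < T) :
    ∫ t in (0 : ℝ)..T, t ^ (a - 1) * Real.exp (-(r * t)) ≤ Real.Gamma a / r ^ a := by
  have h1 := Real.integral_rpow_mul_exp_neg_mul_Ioi ha hr
  rw [Real.div_rpow zero_le_one hr.le, Real.one_rpow] at h1
  rw [intervalIntegral.integral_of_le hT.le, show Real.Gamma a / r ^ a = 1 / r ^ a * Real.Gamma a by ring, ← h1]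
  refine MeasureTheory.setIntegral_mono_set (gint ha hr) ?_ Set.Ioc_subset_Ioi_self.eventuallyLE
  refine (MeasureTheory.ae_restrict_iff' measurableSet_Ioi).2 (Filter.Eventually.of_forall (fun t ht => ?_))
  exact mul_nonneg (Real.rpow_nonneg (le_of_lt ht) _) (Real.exp_nonneg _)

lemma gint_tendsto {a r : ℝ} (ha : 0 < a) (hr : 0 < r) :
    Filter.Tendsto (fun T : ℝ => ∫ t in (0 : ℝ)..T, t ^ (a - 1) * Real.exp (-(r * t))) Filter.atTop
      (nhds (Real.Gamma a / r ^ a)) := by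
  have h1 := Real.integral_rpow_mul_exp_neg_mul_Ioi ha hr
  rw [Real.div_rpow zero_le_one hr.le, Real.one_rpow] at h1
  rw [show Real.Gamma a / r ^ a = 1 / r ^ a * Real.Gamma a by ring, ← h1]
  exact MeasureTheory.intervalIntegral_tendsto_integral_Ioi 0 (gint ha hr) Filter.tendsto_id

lemma Kf_cont {l m c : ℝ} (hl : 1 < l) : Continuous (Kf l m c) := by
  unfold Kf
  have h1 : Continuous (fun t : ℝ => Real.sinh t ^ (l - 1)) :=
    Real.continuous_sinh.rpow_const (fun _ => Or.inr (by linarith))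
  have h0 : Continuous Real.tanh := by
    have : Real.tanh = fun x => Real.sinh x / Real.cosh x := by
      funext x; exact Real.tanh_eq_sinh_div_cosh x
    rw [this]
    exact Real.continuous_sinh.div Real.continuous_cosh (fun x => (Real.cosh_pos x).ne')
  have h3 : Continuous (fun t : ℝ => Real.tanh (t / 2)) := h0.comp (by fun_prop)
  refine Continuous.mul (Complex.continuous_ofReal.comp (Continuous.mul (by fun_prop) h1)) ?_
  refine Continuous.cpow (by fun_prop) continuous_const (fun t => Or.inl ?_)
  rw [Complex.add_re, Complex.one_re, Complex.mul_re, Complex.I_re, Complex.I_im, Complex.ofReal_im]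
  norm_num

/-- The bound for the remainder integral. -/
noncomputable def Bd (l r1 r2 c : ℝ) : ℝ :=
  (l - 1) * 2 ^ (l / 2) * (c * (Real.Gamma (l + 1) / r1 ^ (l + 1)) +
    2 / 3 * (Real.Gamma (l + 2) / r1 ^ (l + 2)) +
    2 ^ (2 - l) * c ^ (l - 2) * (c * (Real.Gamma (2 * l - 1) / r2 ^ (2 * l - 1)) +
      2 / 3 * (Real.Gamma (2 * l) / r2 ^ (2 * l))))

lemma Kf_int_bound {l m c T : ℝ} (hl : 2 < l) (hr1 : 0 < m - l + 1) (hr2 : 0 < m - 2 * l + 3) (hT : 0 < T) :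
    ‖(∫ t in (0 : ℝ)..T, Kf l m c t) -
      ((∫ t in (0 : ℝ)..T, t ^ (l - 1) * Real.exp (-(m * t)) : ℝ) : ℂ)‖ ≤
      Bd l (m - l + 1) (m - 2 * l + 3) |c| := by
  have hm : 0 < m := by linarith
  have hg := gint_int (a := l) (r := m) (by linarith) hm hT
  have hgc : IntervalIntegrable (fun t : ℝ => ((t ^ (l - 1) * Real.exp (-(m * t)) : ℝ) : ℂ))
      MeasureTheory.volume 0 T := ⟨hg.1.ofReal, hg.2.ofReal⟩
  have hKi : IntervalIntegrable (Kf l m c) MeasureTheory.volume 0 T :=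
    (Kf_cont (by linarith)).intervalIntegrable _ _
  rw [← intervalIntegral.integral_ofReal, ← intervalIntegral.integral_sub hKi hgc]
  set r1 := m - l + 1 with hr1d
  set r2 := m - 2 * l + 3 with hr2d
  have i1 := gint_int (a := l + 1) (r := r1) (by linarith) hr1 hT
  have i2 := gint_int (a := l + 2) (r := r1) (by linarith) hr1 hT
  have i3 := gint_int (a := 2 * l - 1) (r := r2) (by linarith) hr2 hT
  have i4 := gint_int (a := 2 * l) (r := r2) (by linarith) hr2 hT
  have j1 := gint_le (a := l + 1) (r := r1) (by linarith) hr1 hT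
  have j2 := gint_le (a := l + 2) (r := r1) (by linarith) hr1 hT
  have j3 := gint_le (a := 2 * l - 1) (r := r2) (by linarith) hr2 hT
  have j4 := gint_le (a := 2 * l) (r := r2) (by linarith) hr2 hT
  have k12 := (i1.const_mul |c|).add (i2.const_mul (2 / 3))
  have k34 := ((i3.const_mul |c|).add (i4.const_mul (2 / 3))).const_mul (2 ^ (2 - l) * |c| ^ (l - 2))
  have k := (k12.add k34).const_mul ((l - 1) * 2 ^ (l / 2))
  refine (intervalIntegral.norm_integral_le_of_norm_le hT.le
    (Filter.Eventually.of_forall (fun t ht => ?_)) k).trans ?_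
  · have ht0 : 0 < t := ht.1
    refine (Kf_bound hl ht0).trans (le_of_eq ?_)
    have e1 : t ^ (l + 1 - 1) = t ^ l := by congr 1; ring
    have e2 : t ^ (l + 2 - 1) = t ^ (l + 1) := by congr 1; ring
    have e3 : t ^ (2 * l - 1 - 1) = t ^ l * t ^ (l - 2) := by rw [← Real.rpow_add ht0]; congr 1; ring
    have e4 : t ^ (2 * l - 1) = t ^ (l + 1) * t ^ (l - 2) := by rw [← Real.rpow_add ht0]; congr 1; ring
    rw [e1, e2, e3, e4]
    ring
  · rw [intervalIntegral.integral_const_mul, intervalIntegral.integral_add k12 k34,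
      intervalIntegral.integral_const_mul, intervalIntegral.integral_add (i1.const_mul _) (i2.const_mul _),
      intervalIntegral.integral_add (i3.const_mul _) (i4.const_mul _)]
    simp only [intervalIntegral.integral_const_mul]
    unfold Bd
    have hl1 : 0 < l - 1 := by linarith
    gcongr

lemma main_bound {l m φ : ℝ} (hl : 2 < l) (hr1 : 0 < m - l + 1) (hr2 : 0 < m - 2 * l + 3)
    (hφ : φ ∈ Set.Ioo 0 π) :
    |Real.sin φ ^ (1 - l) * (∫ θ in (0 : ℝ)..φ, Real.cos (m * θ) * (Real.cos θ - Real.cos φ) ^ (l - 1)) -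
      Real.Gamma l / m ^ l * Real.cos (m * φ - l * π / 2)| ≤
      Bd l (m - l + 1) (m - 2 * l + 3) |Real.cos φ / Real.sin φ| := by
  have hm : 0 < m := by linarith
  have hS : 0 < Real.sin φ := Real.sin_pos_of_pos_of_lt_pi hφ.1 hφ.2
  set M := ∫ θ in (0 : ℝ)..φ, Real.cos (m * θ) * (Real.cos θ - Real.cos φ) ^ (l - 1) with hM
  set c := Real.cos φ / Real.sin φ with hc
  set α := m * φ - l * π / 2 with hα
  set B := Bd l (m - l + 1) (m - 2 * l + 3) |c| with hB
  have hSS : Real.sin φ ^ (1 - l) * Real.sin φ ^ (l - 1) = 1 := by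
    rw [← Real.rpow_add hS, show 1 - l + (l - 1) = 0 by ring, Real.rpow_zero]
  have hev : ∀ T : ℝ, 0 < T →
      |Real.sin φ ^ (1 - l) * M - (∫ t in (0 : ℝ)..T, t ^ (l - 1) * Real.exp (-(m * t))) * Real.cos α| ≤
      B + Real.sin φ ^ (1 - l) * (2 ^ (l - 1) * Real.exp (-((m - l + 1) * T)) * φ) := by
    intro T hT
    have h1 := contour (l := l) (m := m) (by linarith) hφ hT
    have h2 := Kf_int_bound (c := c) hl hr1 hr2 hT
    rw [← hM, ← hc, ← hα] at h1
    set G := ∫ t in (0 : ℝ)..T, t ^ (l - 1) * Real.exp (-(m * t)) with hG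
    set X := ∫ t in (0 : ℝ)..T, Kf l m c t with hX
    have h3 : |(Complex.exp (α * Complex.I) * (X - (G : ℂ))).re| ≤ B := by
      refine (Complex.abs_re_le_norm _).trans ?_
      rw [norm_mul, Complex.norm_exp_ofReal_mul_I, one_mul]
      exact h2
    rw [mul_sub, Complex.sub_re, Complex.re_mul_ofReal, Complex.exp_ofReal_mul_I_re] at h3
    have h4 := mul_le_mul_of_nonneg_left h1 (Real.rpow_nonneg hS.le (1 - l))
    rw [← abs_of_nonneg (Real.rpow_nonneg hS.le (1 - l)), ← abs_mul,
      abs_of_nonneg (Real.rpow_nonneg hS.le (1 - l))] at h4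
    set R := (Complex.exp (α * Complex.I) * X).re
    have e : Real.sin φ ^ (1 - l) * M - G * Real.cos α =
        Real.sin φ ^ (1 - l) * (M - Real.sin φ ^ (l - 1) * R) + (R - Real.cos α * G) := by
      linear_combination R * hSS
    rw [e]
    refine (abs_add_le _ _).trans ?_
    linarith
  have t1 : Filter.Tendsto (fun T : ℝ => |Real.sin φ ^ (1 - l) * M -
      (∫ t in (0 : ℝ)..T, t ^ (l - 1) * Real.exp (-(m * t))) * Real.cos α|) Filter.atTop
      (nhds |Real.sin φ ^ (1 - l) * M - Real.Gamma l / m ^ l * Real.cos α|) :=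
    (tendsto_const_nhds.sub ((gint_tendsto (by linarith) hm).mul_const _)).abs
  have t0 : Filter.Tendsto (fun T : ℝ => Real.exp (-((m - l + 1) * T))) Filter.atTop (nhds 0) :=
    Real.tendsto_exp_neg_atTop_nhds_zero.comp (Filter.tendsto_id.const_mul_atTop hr1)
  have t2 : Filter.Tendsto (fun T : ℝ => B + Real.sin φ ^ (1 - l) *
      (2 ^ (l - 1) * Real.exp (-((m - l + 1) * T)) * φ)) Filter.atTop (nhds B) := by
    have := ((((t0.const_mul (2 ^ (l - 1))).mul_const φ).const_mul (Real.sin φ ^ (1 - l))).const_add B)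
    simpa using this
  exact le_of_tendsto_of_tendsto t1 t2 ((Filter.eventually_gt_atTop 0).mono hev)

theorem ggf_residual_bound_large_lambda (lam nu : ℝ) (hlam : 2 < lam)
    (hnl : lam - 3 < nu) (hnu : 0 < nu) (φ : ℝ) (hφ : φ ∈ Set.Ioo 0 π) :
    |Real.sin φ ^ lam * rG lam nu (Real.cos φ) -
        (2 ^ lam * Real.Gamma (lam + 1 / 2)) / (Real.sqrt π * (nu + lam) ^ lam) *
          Real.cos ((nu + lam) * φ - lam * π / 2)| ≤
      (lam * (lam - 1) * 2 ^ (3 * lam / 2) * Real.Gamma (lam + 1 / 2)) /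
          (Real.sqrt π * (nu + 1) ^ (lam + 1)) *
        (|Real.cos φ / Real.sin φ| + 2 / 3 * (lam + 1) / (nu + 1) +
          (2 ^ (2 - lam) * Real.Gamma (2 * lam - 1) / Real.Gamma (lam + 1)) *
            ((nu + 1) ^ (lam + 1) / (nu - lam + 3) ^ (2 * lam - 1)) *
            |Real.cos φ / Real.sin φ| ^ (lam - 2) *
            (|Real.cos φ / Real.sin φ| + 2 / 3 * (2 * lam - 1) / (nu - lam + 3))) := by
  have hl0 : 0 < lam := by linarith
  have hn1 : 0 < nu + 1 := by linarith
  have hn2 : 0 < nu - lam + 3 := by linarith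
  have hm : 0 < nu + lam := by linarith
  have h := main_bound (l := lam) (m := nu + lam) hlam (by linarith) (by linarith) hφ
  have hG : 0 < Real.Gamma lam := Real.Gamma_pos_of_pos hl0
  have hGh : 0 < Real.Gamma (lam + 1 / 2) := Real.Gamma_pos_of_pos (by linarith)
  have hpi : 0 < Real.sqrt π := Real.sqrt_pos.2 Real.pi_pos
  rw [mehler (by linarith) hm hφ]
  rw [show nu + lam - lam + 1 = nu + 1 by ring, show nu + lam - 2 * lam + 3 = nu - lam + 3 by ring] at h
  set M := ∫ θ in (0 : ℝ)..φ, Real.cos ((nu + lam) * θ) * (Real.cos θ - Real.cos φ) ^ (lam - 1) with hM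
  set c := |Real.cos φ / Real.sin φ| with hc
  have hC : 0 < 2 ^ lam * Real.Gamma (lam + 1 / 2) / (Real.sqrt π * Real.Gamma lam) := by positivity
  have e1 : 2 ^ lam * Real.Gamma (lam + 1 / 2) / (Real.sqrt π * Real.Gamma lam) * Real.sin φ ^ (1 - lam) * M -
      (2 ^ lam * Real.Gamma (lam + 1 / 2)) / (Real.sqrt π * (nu + lam) ^ lam) *
          Real.cos ((nu + lam) * φ - lam * π / 2) =
      2 ^ lam * Real.Gamma (lam + 1 / 2) / (Real.sqrt π * Real.Gamma lam) *
        (Real.sin φ ^ (1 - lam) * M - Real.Gamma lam / (nu + lam) ^ lam *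
          Real.cos ((nu + lam) * φ - lam * π / 2)) := by
    have := Real.rpow_pos_of_pos hm lam
    field_simp
  rw [e1, abs_mul, abs_of_pos hC]
  refine (mul_le_mul_of_nonneg_left h hC.le).trans (le_of_eq ?_)
  unfold Bd
  have g1 : Real.Gamma (lam + 1) = lam * Real.Gamma lam := Real.Gamma_add_one hl0.ne'
  have g2 : Real.Gamma (lam + 2) = (lam + 1) * (lam * Real.Gamma lam) := by
    rw [show lam + 2 = (lam + 1) + 1 by ring, Real.Gamma_add_one (by linarith), g1]
  have g3 : Real.Gamma (2 * lam) = (2 * lam - 1) * Real.Gamma (2 * lam - 1) := by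
    rw [← Real.Gamma_add_one (by linarith)]; congr 1; ring
  have p1 : (2 : ℝ) ^ (3 * lam / 2) = 2 ^ lam * 2 ^ (lam / 2) := by
    rw [← Real.rpow_add (by norm_num)]; congr 1; ring
  have p2 : (nu + 1) ^ (lam + 2) = (nu + 1) ^ (lam + 1) * (nu + 1) := by
    rw [← Real.rpow_add_one hn1.ne']; congr 1; ring
  have p3 : (nu - lam + 3) ^ (2 * lam) = (nu - lam + 3) ^ (2 * lam - 1) * (nu - lam + 3) := by
    rw [← Real.rpow_add_one hn2.ne']; congr 1; ring
  rw [g1, g2, g3, p1, p2, p3]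
  have q1 := Real.rpow_pos_of_pos hn1 (lam + 1)
  have q2 := Real.rpow_pos_of_pos hn2 (2 * lam - 1)
  generalize (nu + 1) ^ (lam + 1) = P at *
  generalize (nu - lam + 3) ^ (2 * lam - 1) = Q at *
  generalize nu + 1 = a at *
  generalize nu - lam + 3 = b at *
  generalize (2 : ℝ) ^ (2 - lam) = D at *
  generalize c ^ (lam - 2) = cc at *
  generalize (2 : ℝ) ^ (lam / 2) = F at *
  field_simp
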